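/- Let f be a function on (Σ_N²)^n and let m ≥ 1 be an integer. Then there is a constant K depending only on n and m such that for all N ≥ 1, all β, t, s ∈ [0,1], and all r₁, r₂ > 0 with 1/r₁ + 1/r₂ = 1 and m·r₂ an even integer, |∂^m/∂s^m E⟨f⟩_{t,s}| ≤ K·(E⟨|f|^{r₁}⟩_t)^{1/r₁}·(E⟨|R(σ¹,σ²)|^{m r₂}⟩)^{1/r₂}, where ⟨·⟩_t = ⟨·⟩_{t,1} and ⟨·⟩ is the Gibbs average of the original single SK system at inverse temperature β. -/

import Mathlib

open MeasureTheory ProbabilityTheory Real Finset Filter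

noncomputable section

/-- Spin configurations: each of the `N` sites carries a `±1` spin, encoded by a `Bool`. -/
abbrev Config (N : ℕ) := Fin N → Bool

/-- The `±1` value of a spin. -/
def spin (b : Bool) : ℝ := if b then 1 else -1

/-- The value of the last spin `σ_N` (junk value `0` when `N = 0`). -/
def spinLast {N : ℕ} (σ : Config N) : ℝ :=
  if h : 0 < N then spin (σ ⟨N - 1, Nat.sub_lt h Nat.one_pos⟩) else 0

/-- The Gaussian disorder: i.i.d. standard Gaussians indexed by pairs `(i, j)`
(only the entries with `i < j` are used). -/
def gaussPi (N : ℕ) : Measure (Fin N × Fin N → ℝ) :=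
  Measure.pi fun _ => gaussianReal 0 1

instance (N : ℕ) : IsProbabilityMeasure (gaussPi N) := by
  unfold gaussPi; infer_instance

/-- Three independent copies `g, g', g''` of the disorder. -/
def disM3 (N : ℕ) :
    Measure ((Fin N × Fin N → ℝ) × (Fin N × Fin N → ℝ) × (Fin N × Fin N → ℝ)) :=
  (gaussPi N).prod ((gaussPi N).prod (gaussPi N))

/-- The SK Hamiltonian `H_{N,β}(σ) = (β/√N) ∑_{i<j} g_{ij} σ_i σ_j`. -/
def ham (N : ℕ) (β : ℝ) (g : Fin N × Fin N → ℝ) (σ : Config N) : ℝ :=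
  (β / Real.sqrt N) *
    ∑ p ∈ Finset.univ.filter (fun p : Fin N × Fin N => p.1 < p.2),
      g p * spin (σ p.1) * spin (σ p.2)

/-- The cavity Hamiltonian `H⁻_N(σ) = (β/√N) ∑_{i<j<N} g_{ij} σ_i σ_j` on the first
`N - 1` spins. -/
def hamCav (N : ℕ) (β : ℝ) (g : Fin N × Fin N → ℝ) (σ : Config N) : ℝ :=
  (β / Real.sqrt N) *
    ∑ p ∈ Finset.univ.filter
        (fun p : Fin N × Fin N => p.1 < p.2 ∧ (p.2 : ℕ) < N - 1),
      g p * spin (σ p.1) * spin (σ p.2)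

/-- The overlap `R(σ¹,σ²) = (1/N) ∑_{i ≤ N} σ_i¹ σ_i²`. -/
def ovlp (N : ℕ) (σ τ : Config N) : ℝ := (∑ i, spin (σ i) * spin (τ i)) / N

/-- The truncated overlap `R⁻(σ¹,σ²) = (1/N) ∑_{i ≤ N−1} σ_i¹ σ_i²`. -/
def ovlpm (N : ℕ) (σ τ : Config N) : ℝ :=
  (∑ i ∈ Finset.univ.filter (fun i : Fin N => (i : ℕ) < N - 1),
    spin (σ i) * spin (τ i)) / N

/-- The partition function `Z_N(β)`. -/
def partFun (N : ℕ) (β : ℝ) (g : Fin N × Fin N → ℝ) : ℝ :=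
  ∑ σ : Config N, Real.exp (ham N β g σ)

/-- The free energy `F_N(β) = ln Z_N(β)`. -/
def freeEnergy (N : ℕ) (β : ℝ) (g : Fin N × Fin N → ℝ) : ℝ :=
  Real.log (partFun N β g)

/-- Two-replica Gibbs average `⟨f⟩` for the single SK system. -/
def gibbs2 (N : ℕ) (β : ℝ) (g : Fin N × Fin N → ℝ)
    (f : Config N → Config N → ℝ) : ℝ :=
  (∑ σ : Config N, ∑ τ : Config N,
    f σ τ * Real.exp (ham N β g σ + ham N β g τ)) / (partFun N β g) ^ 2

/-- Disorder expectation of the two-replica Gibbs average. -/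
def Egibbs2 (N : ℕ) (β : ℝ) (f : Config N → Config N → ℝ) : ℝ :=
  ∫ g, gibbs2 N β g f ∂gaussPi N

/-- The interpolated Hamiltonian `√t · H_N + √(1−t) · H'_N`. -/
def hamT (N : ℕ) (β t : ℝ) (g g' : Fin N × Fin N → ℝ) (σ : Config N) : ℝ :=
  Real.sqrt t * ham N β g σ + Real.sqrt (1 - t) * ham N β g' σ

/-- The coupled Gibbs weight `exp(H¹_{N,t}(σ) + H²_{N,t}(τ))`. -/
def wT (N : ℕ) (β t : ℝ) (g g' g'' : Fin N × Fin N → ℝ)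
    (ρ : Config N × Config N) : ℝ :=
  Real.exp (hamT N β t g g' ρ.1 + hamT N β t g g'' ρ.2)

/-- The coupled Gibbs average `⟨f⟩_t` of a function of one pair `(σ, τ)`. -/
def gibbsT (N : ℕ) (β t : ℝ) (g g' g'' : Fin N × Fin N → ℝ)
    (f : Config N × Config N → ℝ) : ℝ :=
  (∑ ρ : Config N × Config N, f ρ * wT N β t g g' g'' ρ) /
    (∑ ρ : Config N × Config N, wT N β t g g' g'' ρ)

/-- The coupled Gibbs average `⟨f⟩_t` of a function of two pairs. -/
def gibbsT2 (N : ℕ) (β t : ℝ) (g g' g'' : Fin N × Fin N → ℝ)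
    (f : Config N × Config N → Config N × Config N → ℝ) : ℝ :=
  (∑ ρ₁ : Config N × Config N, ∑ ρ₂ : Config N × Config N,
    f ρ₁ ρ₂ * wT N β t g g' g'' ρ₁ * wT N β t g g' g'' ρ₂) /
    (∑ ρ : Config N × Config N, wT N β t g g' g'' ρ) ^ 2

/-- Disorder expectation `E⟨f⟩_t` (one pair). -/
def EgibbsT (N : ℕ) (β t : ℝ) (f : Config N × Config N → ℝ) : ℝ :=
  ∫ ω, gibbsT N β t ω.1 ω.2.1 ω.2.2 f ∂disM3 N

/-- Disorder expectation `E⟨f⟩_t` (two pairs). -/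
def EgibbsT2 (N : ℕ) (β t : ℝ)
    (f : Config N × Config N → Config N × Config N → ℝ) : ℝ :=
  ∫ ω, gibbsT2 N β t ω.1 ω.2.1 ω.2.2 f ∂disM3 N

/-- The `s`-dependent cavity field term
`(β/√N) σ_N ∑_{i<N} (√t g_{iN} + √(1−t) g'_{iN}) σ_i`. -/
def cavField (N : ℕ) (β t : ℝ) (g g' : Fin N × Fin N → ℝ) (σ : Config N) : ℝ :=
  if h : 0 < N then
    (β / Real.sqrt N) * spin (σ ⟨N - 1, Nat.sub_lt h Nat.one_pos⟩) *
      ∑ i ∈ Finset.univ.filter (fun i : Fin N => (i : ℕ) < N - 1),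
        (Real.sqrt t * g (i, ⟨N - 1, Nat.sub_lt h Nat.one_pos⟩) +
          Real.sqrt (1 - t) * g' (i, ⟨N - 1, Nat.sub_lt h Nat.one_pos⟩)) * spin (σ i)
  else 0

/-- The cavity-interpolated Hamiltonian `H^1_{N,t,s}` (resp. `H^2_{N,t,s}` with `g''`). -/
def hamTS (N : ℕ) (β t s : ℝ) (g g' : Fin N × Fin N → ℝ) (σ : Config N) : ℝ :=
  Real.sqrt t * hamCav N β g σ + Real.sqrt (1 - t) * hamCav N β g' σ +
    Real.sqrt s * cavField N β t g g' σ

/-- The coupled cavity Gibbs weight `exp(H¹_{N,t,s}(σ) + H²_{N,t,s}(τ))`. -/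
def wTS (N : ℕ) (β t s : ℝ) (g g' g'' : Fin N × Fin N → ℝ)
    (ρ : Config N × Config N) : ℝ :=
  Real.exp (hamTS N β t s g g' ρ.1 + hamTS N β t s g g'' ρ.2)

/-- The coupled cavity Gibbs average `⟨f⟩_{t,s}` of a function of one pair. -/
def gibbsTS1 (N : ℕ) (β t s : ℝ) (g g' g'' : Fin N × Fin N → ℝ)
    (f : Config N × Config N → ℝ) : ℝ :=
  (∑ ρ : Config N × Config N, f ρ * wTS N β t s g g' g'' ρ) /
    (∑ ρ : Config N × Config N, wTS N β t s g g' g'' ρ)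

/-- The coupled cavity Gibbs average `⟨f⟩_{t,s}` of a function of two pairs. -/
def gibbsTS2 (N : ℕ) (β t s : ℝ) (g g' g'' : Fin N × Fin N → ℝ)
    (f : Config N × Config N → Config N × Config N → ℝ) : ℝ :=
  (∑ ρ₁ : Config N × Config N, ∑ ρ₂ : Config N × Config N,
    f ρ₁ ρ₂ * wTS N β t s g g' g'' ρ₁ * wTS N β t s g g' g'' ρ₂) /
    (∑ ρ : Config N × Config N, wTS N β t s g g' g'' ρ) ^ 2

/-- The coupled cavity Gibbs average `⟨f⟩_{t,s}` of a function of `n` pairs. -/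
def gibbsTSn (N : ℕ) (β t s : ℝ) (g g' g'' : Fin N × Fin N → ℝ) {n : ℕ}
    (f : (Fin n → Config N × Config N) → ℝ) : ℝ :=
  (∑ ρ : Fin n → Config N × Config N, f ρ * ∏ l, wTS N β t s g g' g'' (ρ l)) /
    (∑ ρ₀ : Config N × Config N, wTS N β t s g g' g'' ρ₀) ^ n

/-- Disorder expectation `E⟨f⟩_{t,s}` (one pair). -/
def EgibbsTS1 (N : ℕ) (β t s : ℝ) (f : Config N × Config N → ℝ) : ℝ :=
  ∫ ω, gibbsTS1 N β t s ω.1 ω.2.1 ω.2.2 f ∂disM3 N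

/-- Disorder expectation `E⟨f⟩_{t,s}` (two pairs). -/
def EgibbsTS2 (N : ℕ) (β t s : ℝ)
    (f : Config N × Config N → Config N × Config N → ℝ) : ℝ :=
  ∫ ω, gibbsTS2 N β t s ω.1 ω.2.1 ω.2.2 f ∂disM3 N

/-- Disorder expectation `E⟨f⟩_{t,s}` (`n` pairs). -/
def EgibbsTSn (N : ℕ) (β t s : ℝ) {n : ℕ}
    (f : (Fin n → Config N × Config N) → ℝ) : ℝ :=
  ∫ ω, gibbsTSn N β t s ω.1 ω.2.1 ω.2.2 f ∂disM3 N

/-- The covariance kernel `U(ρ, ρ')` of the `s`-part of the coupled cavity Hamiltonians. -/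
def Ufun (N : ℕ) (β t : ℝ) (ρ ρ' : Config N × Config N) : ℝ :=
  β ^ 2 / 2 * (spinLast ρ.1 * spinLast ρ'.1 * ovlpm N ρ.1 ρ'.1 +
      spinLast ρ.2 * spinLast ρ'.2 * ovlpm N ρ.2 ρ'.2) +
    β ^ 2 * t / 2 * (spinLast ρ.1 * spinLast ρ'.2 * ovlpm N ρ.1 ρ'.2 +
      spinLast ρ.2 * spinLast ρ'.1 * ovlpm N ρ.2 ρ'.1)

/-- `ν(β) = −(1/2)·ln(1 − β²) − β²/2`. -/
def nuSK (b : ℝ) : ℝ := -(1 / 2) * Real.log (1 - b ^ 2) - b ^ 2 / 2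

section Gibbs

variable {S : Type} [Fintype S]

/-- The normalised Gibbs weight of the energy `H` on a finite state space. -/
def gibbsWeight (H : S → ℝ) (ρ : S) : ℝ := exp (H ρ) / ∑ ρ', exp (H ρ')

/-- The Gibbs average of a function of `n` independent replicas. -/
def replicaAvg (n : ℕ) (H : S → ℝ) (f : (Fin n → S) → ℝ) : ℝ :=
  ∑ ρ, f ρ * ∏ l, gibbsWeight H (ρ l)

/-- The coefficients of the observable produced by differentiating an `n`-replica Gibbs average:
`-n` for the new replica, `1` for each old one. -/
def replicaCoeff (n : ℕ) : Fin (n + 1) → ℝ := Fin.cons (-n : ℝ) fun _ => 1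

lemma sum_exp_pos [Nonempty S] (H : S → ℝ) : 0 < ∑ ρ, exp (H ρ) :=
  Finset.sum_pos (fun _ _ => exp_pos _) Finset.univ_nonempty

lemma gibbsWeight_nonneg (H : S → ℝ) (ρ : S) : 0 ≤ gibbsWeight H ρ := by
  unfold gibbsWeight; positivity

lemma sum_gibbsWeight [Nonempty S] (H : S → ℝ) : ∑ ρ, gibbsWeight H ρ = 1 := by
  simp only [gibbsWeight, ← Finset.sum_div]
  exact div_self (sum_exp_pos H).ne'

lemma gibbsWeight_le_one [Nonempty S] (H : S → ℝ) (ρ : S) : gibbsWeight H ρ ≤ 1 := by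
  rw [← sum_gibbsWeight H]
  exact Finset.single_le_sum (fun ρ' _ => gibbsWeight_nonneg H ρ') (Finset.mem_univ ρ)

lemma sum_fin_succ_fun {n : ℕ} (F : (Fin (n + 1) → S) → ℝ) :
    ∑ ρ, F ρ = ∑ ρ₀, ∑ ρ : Fin n → S, F (Fin.cons ρ₀ ρ) := by
  rw [← Fintype.sum_prod_type', ← (Fin.consEquiv fun _ : Fin (n + 1) => S).sum_comp]
  rfl

lemma replicaAvg_succ (n : ℕ) (H : S → ℝ) (F : (Fin (n + 1) → S) → ℝ) :
    replicaAvg (n + 1) H F =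
      ∑ ρ₀, gibbsWeight H ρ₀ * replicaAvg n H (fun ρ => F (Fin.cons ρ₀ ρ)) := by
  simp only [replicaAvg, sum_fin_succ_fun, Fin.prod_univ_succ, Fin.cons_zero, Fin.cons_succ,
    Finset.mul_sum]
  exact Finset.sum_congr rfl fun _ _ => Finset.sum_congr rfl fun _ _ => by ring

lemma replicaAvg_tail [Nonempty S] (n : ℕ) (H : S → ℝ) (f : (Fin n → S) → ℝ) :
    replicaAvg (n + 1) H (fun ρ => f (Fin.tail ρ)) = replicaAvg n H f := by
  simp [replicaAvg_succ, ← Finset.sum_mul, sum_gibbsWeight]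

lemma replicaAvg_mono (n : ℕ) (H : S → ℝ) {f g : (Fin n → S) → ℝ} (h : ∀ ρ, f ρ ≤ g ρ) :
    replicaAvg n H f ≤ replicaAvg n H g :=
  Finset.sum_le_sum fun ρ _ => mul_le_mul_of_nonneg_right (h ρ)
    (Finset.prod_nonneg fun _ _ => gibbsWeight_nonneg H _)

lemma replicaAvg_sum_mul {ι : Type*} (s : Finset ι) (n : ℕ) (H : S → ℝ) (c : ι → ℝ)
    (f : ι → (Fin n → S) → ℝ) :
    replicaAvg n H (fun ρ => ∑ i ∈ s, c i * f i ρ) = ∑ i ∈ s, c i * replicaAvg n H (f i) := by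
  simp only [replicaAvg, Finset.sum_mul, Finset.mul_sum]
  rw [Finset.sum_comm]
  exact Finset.sum_congr rfl fun _ _ => Finset.sum_congr rfl fun _ _ => by ring

lemma abs_replicaAvg_le [Nonempty S] (n : ℕ) (H : S → ℝ) (f : (Fin n → S) → ℝ) :
    |replicaAvg n H f| ≤ ∑ ρ, |f ρ| := by
  refine (Finset.abs_sum_le_sum_abs _ _).trans (Finset.sum_le_sum fun ρ _ => ?_)
  rw [abs_mul, abs_of_nonneg (Finset.prod_nonneg fun _ _ => gibbsWeight_nonneg H _)]
  exact mul_le_of_le_one_right (abs_nonneg _)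
    (Finset.prod_le_one (fun _ _ => gibbsWeight_nonneg H _) fun _ _ => gibbsWeight_le_one H _)

lemma continuous_replicaAvg [Nonempty S] {X : Type*} [TopologicalSpace X] (n : ℕ) {H : X → S → ℝ}
    (hH : ∀ ρ, Continuous fun x => H x ρ) (f : (Fin n → S) → ℝ) :
    Continuous fun x => replicaAvg n (H x) f := by
  unfold replicaAvg gibbsWeight
  refine continuous_finsetSum _ fun ρ _ => continuous_const.mul
    (continuous_finsetProd _ fun l _ => ?_)
  refine Continuous.div (continuous_exp.comp (hH _)) ?_ fun x => (sum_exp_pos (H x)).ne'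
  exact continuous_finsetSum _ fun ρ' _ => continuous_exp.comp (hH ρ')

lemma hasDerivAt_gibbsWeight [Nonempty S] {H : ℝ → S → ℝ} {e : S → ℝ} {u : ℝ}
    (hH : ∀ ρ, HasDerivAt (fun v => H v ρ) (e ρ) u) (ρ : S) :
    HasDerivAt (fun v => gibbsWeight (H v) ρ)
      (gibbsWeight (H u) ρ * (e ρ - ∑ ρ', gibbsWeight (H u) ρ' * e ρ')) u := by
  have hZ : HasDerivAt (fun v => ∑ ρ', exp (H v ρ')) (∑ ρ', exp (H u ρ') * e ρ') u :=
    HasDerivAt.fun_sum fun ρ' _ => (hH ρ').exp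
  have hpos := (sum_exp_pos (H u)).ne'
  refine ((hH ρ).exp.div hZ hpos).congr_deriv ?_
  simp only [gibbsWeight, div_mul_eq_mul_div, ← Finset.sum_div]
  field_simp

lemma hasDerivAt_replicaAvg [Nonempty S] (n : ℕ) {H : ℝ → S → ℝ} {e : S → ℝ} {u : ℝ}
    (hH : ∀ ρ, HasDerivAt (fun v => H v ρ) (e ρ) u) (f : (Fin n → S) → ℝ) :
    HasDerivAt (fun v => replicaAvg n (H v) f)
      (replicaAvg (n + 1) (H u)
        (fun ρ => f (Fin.tail ρ) * ∑ i, replicaCoeff n i * e (ρ i))) u := by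
  have h : ∀ ρ : Fin n → S, HasDerivAt (fun v => f ρ * ∏ l, gibbsWeight (H v) (ρ l))
      (f ρ * ∑ i, (∏ j ∈ univ.erase i, gibbsWeight (H u) (ρ j)) •
        (gibbsWeight (H u) (ρ i) * (e (ρ i) - ∑ ρ', gibbsWeight (H u) ρ' * e ρ'))) u := fun ρ =>
    (HasDerivAt.fun_finsetProd fun l _ => hasDerivAt_gibbsWeight hH (ρ l)).const_mul _
  refine (HasDerivAt.fun_sum fun ρ _ => h ρ).congr_deriv ?_
  rw [replicaAvg_succ]
  have hswap : ∀ F : S → (Fin n → S) → ℝ, ∑ ρ₀, gibbsWeight (H u) ρ₀ * ∑ ρ, F ρ₀ ρ =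
      ∑ ρ, ∑ ρ₀, gibbsWeight (H u) ρ₀ * F ρ₀ ρ := fun F => by
    simp only [Finset.mul_sum]
    exact Finset.sum_comm
  simp only [replicaAvg, hswap, Fin.tail_cons, Fin.sum_univ_succ, replicaCoeff,
    Fin.cons_zero, Fin.cons_succ, one_mul]
  refine Finset.sum_congr rfl fun ρ _ => ?_
  have h1 : ∀ i, (∏ j ∈ univ.erase i, gibbsWeight (H u) (ρ j)) • (gibbsWeight (H u) (ρ i) *
      (e (ρ i) - ∑ ρ', gibbsWeight (H u) ρ' * e ρ')) = (∏ j, gibbsWeight (H u) (ρ j)) *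
      (e (ρ i) - ∑ ρ', gibbsWeight (H u) ρ' * e ρ') := fun i => by
    rw [← Finset.mul_prod_erase _ _ (Finset.mem_univ i), smul_eq_mul]; ring
  simp only [h1, ← Finset.mul_sum]
  have h2 : ∀ ρ₀ : S, gibbsWeight (H u) ρ₀ * (f ρ * (-(n : ℝ) * e ρ₀ + ∑ i, e (ρ i)) *
      ∏ l, gibbsWeight (H u) (ρ l)) = f ρ * (∏ l, gibbsWeight (H u) (ρ l)) *
      ((∑ i, e (ρ i)) * gibbsWeight (H u) ρ₀ - n * (gibbsWeight (H u) ρ₀ * e ρ₀)) := fun _ => by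
    ring
  simp only [h2, ← Finset.mul_sum, Finset.sum_sub_distrib, sum_gibbsWeight, Finset.sum_const,
    Finset.card_univ, Fintype.card_fin, nsmul_eq_mul]
  ring

end Gibbs

section Gaussian

variable {J : Type} [Fintype J]

/-- The standard Gaussian product measure. -/
def stdGauss (J : Type) [Fintype J] : Measure (J → ℝ) := Measure.pi fun _ => gaussianReal 0 1

instance : IsProbabilityMeasure (stdGauss J) := by unfold stdGauss; infer_instance

lemma hasDerivAt_gaussianPDFReal_zero_one (x : ℝ) :
    HasDerivAt (fun y => -gaussianPDFReal 0 1 y) (x * gaussianPDFReal 0 1 x) x := by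
  simp only [gaussianPDFReal_def, NNReal.coe_one, mul_one, sub_zero]
  have h : HasDerivAt (fun y : ℝ => -y ^ 2 / 2) (-x) x :=
    (((hasDerivAt_pow 2 x).neg).div_const 2).congr_deriv (by push_cast; ring)
  exact ((h.exp.const_mul (√(2 * π))⁻¹).neg).congr_deriv (by ring)

lemma integrable_gaussianReal_iff (g : ℝ → ℝ) :
    Integrable g (gaussianReal 0 1) ↔ Integrable fun x => gaussianPDFReal 0 1 x * g x := by
  rw [gaussianReal_of_var_ne_zero 0 one_ne_zero,
    integrable_withDensity_iff_integrable_smul' (measurable_gaussianPDF 0 1)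
      (ae_of_all _ fun _ => gaussianPDF_lt_top)]
  simp [toReal_gaussianPDF]

/-- Gaussian integration by parts in dimension one. -/
lemma integral_mul_gaussianReal {g g' : ℝ → ℝ} (hg : ∀ x, HasDerivAt g (g' x) x)
    (hi : Integrable g (gaussianReal 0 1)) (hi' : Integrable g' (gaussianReal 0 1))
    (hxi : Integrable (fun x => x * g x) (gaussianReal 0 1)) :
    ∫ x, x * g x ∂gaussianReal 0 1 = ∫ x, g' x ∂gaussianReal 0 1 := by
  rw [integrable_gaussianReal_iff] at hi hi' hxi
  rw [integral_gaussianReal_eq_integral_smul one_ne_zero,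
    integral_gaussianReal_eq_integral_smul one_ne_zero]
  have := integral_mul_deriv_eq_deriv_mul_of_integrable (u := g) (u' := g')
    (v := fun y => -gaussianPDFReal 0 1 y) (v' := fun x => x * gaussianPDFReal 0 1 x)
    (fun x _ => hg x) (fun x _ => hasDerivAt_gaussianPDFReal_zero_one x)
    (hxi.congr (ae_of_all _ fun x => by simp; ring))
    (hi'.neg.congr (ae_of_all _ fun x => by simp; ring))
    (hi.neg.congr (ae_of_all _ fun x => by simp; ring))
  calc _ = ∫ x, g x * (x * gaussianPDFReal 0 1 x) := by
        congr 1; ext x; simp only [smul_eq_mul]; ring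
    _ = _ := by
        rw [this, ← integral_neg]
        congr 1; ext x; simp only [smul_eq_mul]; ring

/-- Resampling one coordinate preserves the Gaussian product measure. -/
lemma measurePreserving_update_stdGauss [DecidableEq J] (j : J) :
    MeasurePreserving (fun p : (J → ℝ) × ℝ => Function.update p.1 j p.2)
      ((stdGauss J).prod (gaussianReal 0 1)) (stdGauss J) := by
  have hm : Measurable fun p : (J → ℝ) × ℝ => Function.update p.1 j p.2 := by
    rw [measurable_pi_iff]
    intro i
    by_cases h : i = j
    · subst h; simpa using measurable_snd
    · simpa [Function.update_of_ne h] using! (measurable_pi_apply i).comp measurable_fst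
  refine ⟨hm, Eq.symm ?_⟩
  refine Measure.pi_eq fun s hs => ?_
  rw [Measure.map_apply hm (MeasurableSet.univ_pi hs)]
  have : (fun p : (J → ℝ) × ℝ => Function.update p.1 j p.2) ⁻¹' (Set.univ.pi s) =
      (Set.univ.pi (Function.update s j Set.univ)) ×ˢ s j := by
    ext ⟨x, y⟩
    simp only [Set.mem_preimage, Set.mem_pi, Set.mem_univ, true_imp_iff, Set.mem_prod]
    constructor
    · intro h
      refine ⟨fun i => ?_, by simpa using h j⟩
      by_cases hi : i = j
      · subst hi; simp
      · simpa [Function.update_of_ne hi] using h i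
    · rintro ⟨h, hy⟩ i
      by_cases hi : i = j
      · subst hi; simpa using hy
      · simpa [Function.update_of_ne hi] using h i
  rw [this, Measure.prod_prod, stdGauss, Measure.pi_pi,
    ← Finset.mul_prod_erase _ _ (Finset.mem_univ j),
    ← Finset.mul_prod_erase (f := fun i => gaussianReal 0 1 (s i)) _ (Finset.mem_univ j)]
  simp only [Function.update_self, measure_univ, one_mul]
  rw [mul_comm]
  congr 1
  exact Finset.prod_congr rfl fun i hi => by rw [Function.update_of_ne (Finset.ne_of_mem_erase hi)]

lemma integrable_eval_stdGauss (j : J) : Integrable (fun x => x j) (stdGauss J) := by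
  have h : Integrable (fun x : ℝ => x) (gaussianReal 0 1) :=
    (memLp_id_gaussianReal 1).integrable le_rfl
  exact (measurePreserving_eval (fun _ : J => gaussianReal 0 1) j).integrable_comp_of_integrable h

lemma integrable_of_continuous_of_bounded {G : (J → ℝ) → ℝ} {C : ℝ} (hG : Continuous G)
    (hC : ∀ x, |G x| ≤ C) : Integrable G (stdGauss J) :=
  Integrable.of_bound hG.aestronglyMeasurable C (ae_of_all _ hC)

/-- Gaussian integration by parts for bounded functions with bounded derivative. -/
lemma integral_eval_mul_stdGauss [DecidableEq J] (j : J) {G G' : (J → ℝ) → ℝ} {C C' : ℝ}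
    (hG : Continuous G) (hG' : Continuous G') (hC : ∀ x, |G x| ≤ C) (hC' : ∀ x, |G' x| ≤ C')
    (hd : ∀ x y, HasDerivAt (fun z => G (Function.update x j z)) (G' (Function.update x j y)) y) :
    ∫ x, x j * G x ∂stdGauss J = ∫ x, G' x ∂stdGauss J := by
  have hmp := measurePreserving_update_stdGauss j
  have hiG' := integrable_of_continuous_of_bounded hG' hC'
  have hixG : Integrable (fun x => x j * G x) (stdGauss J) :=
    (integrable_eval_stdGauss j).mul_bdd hG.aestronglyMeasurable (ae_of_all _ hC)
  have hx : Integrable (fun x : ℝ => x) (gaussianReal 0 1) :=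
    (memLp_id_gaussianReal 1).integrable le_rfl
  have hu : ∀ x : J → ℝ, Continuous fun y : ℝ => Function.update x j y := fun x =>
    continuous_const.update j continuous_id
  have key : ∀ F : (J → ℝ) → ℝ, Integrable F (stdGauss J) → ∫ x, F x ∂stdGauss J =
      ∫ x, ∫ y, F (Function.update x j y) ∂gaussianReal 0 1 ∂stdGauss J := by
    intro F hF
    have h1 := hmp.integrable_comp_of_integrable hF
    rw [← integral_prod (fun p : (J → ℝ) × ℝ => F (Function.update p.1 j p.2)) h1]
    conv_lhs => rw [← hmp.map_eq]
    exact integral_map hmp.measurable.aemeasurable (by rw [hmp.map_eq]; exact hF.1)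
  rw [key _ hixG, key _ hiG']
  congr 1
  ext x
  simp only [Function.update_self]
  refine integral_mul_gaussianReal (hd x) ?_ ?_ ?_
  · exact Integrable.of_bound (hG.comp (hu x)).aestronglyMeasurable C (ae_of_all _ fun y => hC _)
  · exact Integrable.of_bound (hG'.comp (hu x)).aestronglyMeasurable C' (ae_of_all _ fun y => hC' _)
  · exact hx.mul_bdd (hG.comp (hu x)).aestronglyMeasurable (ae_of_all _ fun y => hC _)

end Gaussian

section Interpolation

variable {S J : Type} [Fintype J]

/-- The energy `∑ j, c j ρ * x j` that is linear in the disorder `x`. -/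
def linEnergy (c : J → S → ℝ) (x : J → ℝ) (ρ : S) : ℝ := ∑ j, c j ρ * x j

/-- The coefficients `b + √s a` of the energy interpolating in `s`. -/
def interpCoeff (a b : J → S → ℝ) (s : ℝ) (j : J) (ρ : S) : ℝ := b j ρ + √s * a j ρ

/-- The factor multiplying the observable when `E⟨f⟩_s` is differentiated in `s`, where `U` is
half the covariance of the `s`-dependent part of the energy. -/
def derivFactor (n : ℕ) (U : S → S → ℝ) (ρ : Fin (n + 2) → S) : ℝ :=
  ∑ i, ∑ i', (Fin.cons 0 (replicaCoeff n) : Fin (n + 2) → ℝ) i * replicaCoeff (n + 1) i' *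
    U (ρ i) (ρ i')

lemma continuous_linEnergy (c : J → S → ℝ) (ρ : S) : Continuous fun x => linEnergy c x ρ := by
  unfold linEnergy; fun_prop

lemma hasDerivAt_linEnergy_interpCoeff (a b : J → S → ℝ) {s : ℝ} (hs : 0 < s) (x : J → ℝ) (ρ : S) :
    HasDerivAt (fun v => linEnergy (interpCoeff a b v) x ρ)
      (∑ j, ((2 * √s)⁻¹ * x j) * a j ρ) s := by
  unfold linEnergy interpCoeff
  refine HasDerivAt.fun_sum fun j _ => ?_
  refine ((((hasDerivAt_sqrt hs.ne').mul_const (a j ρ)).const_add (b j ρ)).mul_const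
    (x j)).congr_deriv ?_
  rw [one_div]; ring

lemma sum_mul_eq_derivFactor (n : ℕ) {a b : J → S → ℝ} {U : S → S → ℝ}
    (hab : ∀ ρ ρ', ∑ j, a j ρ * b j ρ' = 0) (haa : ∀ ρ ρ', ∑ j, a j ρ * a j ρ' = 2 * U ρ ρ')
    {s : ℝ} (hs : 0 < s) (ρ : Fin (n + 2) → S) :
    ∑ j, (2 * √s)⁻¹ * ((∑ i, replicaCoeff n i * a j (Fin.tail ρ i)) *
      ∑ i, replicaCoeff (n + 1) i * interpCoeff a b s j (ρ i)) = derivFactor n U ρ := by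
  have h0 : √s ≠ 0 := (sqrt_pos.2 hs).ne'
  have hcov : ∀ ρ ρ', ∑ j, a j ρ * interpCoeff a b s j ρ' = 2 * √s * U ρ ρ' := by
    intro ρ ρ'
    simp only [interpCoeff, mul_add, Finset.sum_add_distrib, hab, zero_add]
    rw [mul_right_comm, ← haa, Finset.sum_mul]
    exact Finset.sum_congr rfl fun _ _ => by ring
  have hU : ∀ ρ ρ', U ρ ρ' = (2 * √s)⁻¹ * ∑ j, a j ρ * interpCoeff a b s j ρ' := by
    intro ρ ρ'
    rw [hcov]; field_simp
  have hA : ∀ j, ∑ i, replicaCoeff n i * a j (Fin.tail ρ i) =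
      ∑ i, (Fin.cons 0 (replicaCoeff n) : Fin (n + 2) → ℝ) i * a j (ρ i) := fun j => by
    rw [Fin.sum_univ_succ (n := n + 1)]
    simp [Fin.tail]
  simp only [hA, derivFactor, hU, Finset.sum_mul_sum]
  simp only [Finset.mul_sum]
  rw [Finset.sum_comm]
  refine Finset.sum_congr rfl fun i _ => ?_
  rw [Finset.sum_comm]
  exact Finset.sum_congr rfl fun i' _ => Finset.sum_congr rfl fun j _ => by ring

variable [Fintype S]

/-- The disorder average of the `n`-replica Gibbs average for a Gaussian linear energy. -/
def quenchedAvg (n : ℕ) (c : J → S → ℝ) (f : (Fin n → S) → ℝ) : ℝ :=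
  ∫ x, replicaAvg n (linEnergy c x) f ∂stdGauss J

variable [Nonempty S]

lemma integrable_replicaAvg (n : ℕ) (c : J → S → ℝ) (f : (Fin n → S) → ℝ) :
    Integrable (fun x => replicaAvg n (linEnergy c x) f) (stdGauss J) :=
  integrable_of_continuous_of_bounded (continuous_replicaAvg n (continuous_linEnergy c) f)
    fun x => abs_replicaAvg_le n (linEnergy c x) f

lemma quenchedAvg_sum_mul {ι : Type*} (s : Finset ι) (n : ℕ) (c : J → S → ℝ) (r : ι → ℝ)
    (f : ι → (Fin n → S) → ℝ) :
    quenchedAvg n c (fun ρ => ∑ i ∈ s, r i * f i ρ) = ∑ i ∈ s, r i * quenchedAvg n c (f i) := by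
  simp only [quenchedAvg, replicaAvg_sum_mul]
  rw [integral_finsetSum _ fun i _ => (integrable_replicaAvg n c (f i)).const_mul _]
  simp only [integral_const_mul]

lemma quenchedAvg_mono (n : ℕ) (c : J → S → ℝ) {f g : (Fin n → S) → ℝ} (h : ∀ ρ, f ρ ≤ g ρ) :
    quenchedAvg n c f ≤ quenchedAvg n c g :=
  integral_mono (integrable_replicaAvg n c f) (integrable_replicaAvg n c g)
    fun x => replicaAvg_mono n (linEnergy c x) h

lemma quenchedAvg_const_mul (n : ℕ) (c : J → S → ℝ) (r : ℝ) (f : (Fin n → S) → ℝ) :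
    quenchedAvg n c (fun ρ => r * f ρ) = r * quenchedAvg n c f := by
  simpa using quenchedAvg_sum_mul {()} n c (fun _ => r) fun _ => f

lemma quenchedAvg_nonneg (n : ℕ) (c : J → S → ℝ) {f : (Fin n → S) → ℝ} (h : ∀ ρ, 0 ≤ f ρ) :
    0 ≤ quenchedAvg n c f := by
  have := quenchedAvg_mono n c (f := fun ρ => 0 * f ρ) (g := f) (by simpa using h)
  rwa [quenchedAvg_const_mul, zero_mul] at this

lemma abs_quenchedAvg_le (n : ℕ) (c : J → S → ℝ) (f : (Fin n → S) → ℝ) :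
    |quenchedAvg n c f| ≤ quenchedAvg n c fun ρ => |f ρ| := by
  rw [abs_le]
  constructor
  · have := quenchedAvg_mono n c (f := fun ρ => (-1) * |f ρ|) (g := f)
      fun ρ => by linarith [neg_abs_le (f ρ)]
    rw [quenchedAvg_const_mul] at this
    linarith
  · exact quenchedAvg_mono n c fun ρ => le_abs_self _

lemma quenchedAvg_tail (n : ℕ) (c : J → S → ℝ) (f : (Fin n → S) → ℝ) :
    quenchedAvg (n + 1) c (fun ρ => f (Fin.tail ρ)) = quenchedAvg n c f := by
  simp only [quenchedAvg, replicaAvg_tail]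

/-- Gaussian integration by parts for Gibbs averages. -/
lemma integral_eval_mul_replicaAvg (n : ℕ) (c : J → S → ℝ) (f : (Fin n → S) → ℝ) (j : J) :
    ∫ x, x j * replicaAvg n (linEnergy c x) f ∂stdGauss J =
      quenchedAvg (n + 1) c
        (fun ρ => f (Fin.tail ρ) * ∑ i, replicaCoeff n i * c j (ρ i)) := by
  classical
  refine integral_eval_mul_stdGauss j (continuous_replicaAvg n (continuous_linEnergy c) f)
    (continuous_replicaAvg _ (continuous_linEnergy c) _)
    (fun x => abs_replicaAvg_le n (linEnergy c x) f)
    (fun x => abs_replicaAvg_le _ (linEnergy c x) _) fun x y => ?_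
  refine hasDerivAt_replicaAvg n (H := fun z => linEnergy c (Function.update x j z)) (fun ρ => ?_) f
  have h := hasDerivAt_pi.1 (hasDerivAt_update x j y)
  refine (HasDerivAt.fun_sum fun i _ => (h i).const_mul (c i ρ)).congr_deriv ?_
  simp [Pi.single_apply]

lemma hasDerivAt_replicaAvg_interpCoeff (n : ℕ) (a b : J → S → ℝ) {s : ℝ} (hs : 0 < s) (x : J → ℝ)
    (f : (Fin n → S) → ℝ) :
    HasDerivAt (fun v => replicaAvg n (linEnergy (interpCoeff a b v) x) f)
      (∑ j, ((2 * √s)⁻¹ * x j) * replicaAvg (n + 1) (linEnergy (interpCoeff a b s) x)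
        (fun ρ => f (Fin.tail ρ) * ∑ i, replicaCoeff n i * a j (ρ i))) s := by
  refine (hasDerivAt_replicaAvg n (hasDerivAt_linEnergy_interpCoeff a b hs x) f).congr_deriv ?_
  rw [← replicaAvg_sum_mul]
  congr 1
  ext ρ
  simp only [Finset.mul_sum]
  rw [Finset.sum_comm]
  exact Finset.sum_congr rfl fun _ _ => Finset.sum_congr rfl fun _ _ => by ring

/-- The derivative in `s` of the interpolated quenched average. -/
theorem hasDerivAt_quenchedAvg (n : ℕ) {a b : J → S → ℝ} {U : S → S → ℝ}
    (hab : ∀ ρ ρ', ∑ j, a j ρ * b j ρ' = 0) (haa : ∀ ρ ρ', ∑ j, a j ρ * a j ρ' = 2 * U ρ ρ')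
    (f : (Fin n → S) → ℝ) {s : ℝ} (hs : 0 < s) :
    HasDerivAt (fun v => quenchedAvg n (interpCoeff a b v) f)
      (quenchedAvg (n + 2) (interpCoeff a b s)
        (fun ρ => f (Fin.tail (Fin.tail ρ)) * derivFactor n U ρ)) s := by
  set fa : J → (Fin (n + 1) → S) → ℝ := fun j ρ =>
    f (Fin.tail ρ) * ∑ i, replicaCoeff n i * a j (ρ i) with hfa
  have hxint : ∀ (v : ℝ) (j : J), Integrable (fun x : J → ℝ => ((2 * √v)⁻¹ * x j) *
      replicaAvg (n + 1) (linEnergy (interpCoeff a b v) x) (fa j)) (stdGauss J) := fun v j =>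
    ((integrable_eval_stdGauss j).const_mul _).mul_bdd
      (continuous_replicaAvg _ (continuous_linEnergy _) _).aestronglyMeasurable
      (ae_of_all _ fun x => abs_replicaAvg_le _ _ _)
  have hmain := (hasDerivAt_integral_of_dominated_loc_of_deriv_le (μ := stdGauss J) (x₀ := s)
    (F := fun v x => replicaAvg n (linEnergy (interpCoeff a b v) x) f)
    (F' := fun v x => ∑ j, ((2 * √v)⁻¹ * x j) *
      replicaAvg (n + 1) (linEnergy (interpCoeff a b v) x) (fa j))
    (bound := fun x => ∑ j, ((2 * √(s / 2))⁻¹ * |x j|) * ∑ ρ, |fa j ρ|)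
    (s := Set.Ioi (s / 2)) (Ioi_mem_nhds (by linarith))
    (Eventually.of_forall fun v => (integrable_replicaAvg n _ f).1)
    (integrable_replicaAvg n _ f)
    (integrable_finsetSum _ fun j _ => hxint s j).1
    (ae_of_all _ fun x v hv => ?_)
    (integrable_finsetSum _ fun j _ =>
      ((integrable_eval_stdGauss j).abs.const_mul _).mul_const _)
    (ae_of_all _ fun x v hv => hasDerivAt_replicaAvg_interpCoeff n a b
      (lt_trans (by linarith) (Set.mem_Ioi.1 hv)) x f)).2
  · refine hmain.congr_deriv ?_
    rw [integral_finsetSum _ fun j _ => hxint s j]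
    have hj : ∀ j, ∫ x, ((2 * √s)⁻¹ * x j) *
        replicaAvg (n + 1) (linEnergy (interpCoeff a b s) x) (fa j) ∂stdGauss J =
        (2 * √s)⁻¹ * quenchedAvg (n + 2) (interpCoeff a b s) (fun ρ => fa j (Fin.tail ρ) *
          ∑ i, replicaCoeff (n + 1) i * interpCoeff a b s j (ρ i)) := fun j => by
      rw [← integral_eval_mul_replicaAvg, ← integral_const_mul]
      simp only [mul_assoc]
    simp only [hj]
    rw [← quenchedAvg_sum_mul]
    congr 1
    ext ρ
    rw [← sum_mul_eq_derivFactor n hab haa hs ρ, Finset.mul_sum]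
    exact Finset.sum_congr rfl fun j _ => by simp only [hfa]; ring
  · refine (norm_sum_le _ _).trans (Finset.sum_le_sum fun j _ => ?_)
    rw [Real.norm_eq_abs, abs_mul, abs_mul, abs_of_nonneg (by positivity : 0 ≤ (2 * √v)⁻¹)]
    have h1 : 0 < √(s / 2) := sqrt_pos.2 (by linarith)
    have h2 : √(s / 2) ≤ √v := sqrt_le_sqrt (Set.mem_Ioi.1 hv).le
    gcongr
    exact abs_replicaAvg_le _ _ _

end Interpolation

section IteratedDerivative

variable {S J : Type} [Fintype J]

/-- The kernel `U` evaluated at a pair of replicas, with its diagonal replaced by `d`. -/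
def pairKernel {n : ℕ} (U : S → S → ℝ) (d : S → ℝ) (ρ : Fin n → S) (i i' : Fin n) : ℝ :=
  if i = i' then d (ρ i) else U (ρ i) (ρ i')

/-- The sum of the absolute values of the kernel over all pairs of replicas. -/
def kernelSum {n : ℕ} (U : S → S → ℝ) (d : S → ℝ) (ρ : Fin n → S) : ℝ :=
  ∑ i, ∑ i', |pairKernel U d ρ i i'|

lemma kernelSum_nonneg {n : ℕ} (U : S → S → ℝ) (d : S → ℝ) (ρ : Fin n → S) :
    0 ≤ kernelSum U d ρ := by
  unfold kernelSum; positivity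

lemma kernelSum_tail_le {n : ℕ} (U : S → S → ℝ) (d : S → ℝ) (ρ : Fin (n + 1) → S) :
    kernelSum U d (Fin.tail ρ) ≤ kernelSum U d ρ := by
  unfold kernelSum
  rw [Fin.sum_univ_succ (n := n)]
  refine le_add_of_nonneg_of_le (by positivity) (Finset.sum_le_sum fun i _ => ?_)
  rw [Fin.sum_univ_succ (n := n)]
  refine le_add_of_nonneg_of_le (by positivity) (Finset.sum_le_sum fun i' _ => ?_)
  simp [pairKernel, Fin.tail]

lemma kernelSum_le {n : ℕ} {U : S → S → ℝ} {d : S → ℝ} {M : ℝ} (hU : ∀ ρ ρ', |U ρ ρ'| ≤ M)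
    (hd : ∀ ρ, |d ρ| ≤ M) (ρ : Fin n → S) : kernelSum U d ρ ≤ n ^ 2 * M := by
  have h : ∀ i i', |pairKernel U d ρ i i'| ≤ M := fun i i' => by
    unfold pairKernel; split_ifs; exacts [hd _, hU _ _]
  calc kernelSum U d ρ ≤ ∑ _i : Fin n, ∑ _i' : Fin n, M :=
        Finset.sum_le_sum fun i _ => Finset.sum_le_sum fun i' _ => h i i'
    _ = n ^ 2 * M := by simp; ring

lemma abs_replicaCoeff_le (n : ℕ) (i : Fin (n + 1)) : |replicaCoeff n i| ≤ n + 1 := by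
  refine Fin.cases ?_ (fun i => ?_) i <;> simp [replicaCoeff]

lemma derivFactor_eq {n : ℕ} {U : S → S → ℝ} {d : S → ℝ} {k : ℝ} (hd : ∀ ρ, U ρ ρ = k + d ρ)
    (ρ : Fin (n + 2) → S) :
    derivFactor n U ρ = ∑ i, ∑ i', (Fin.cons 0 (replicaCoeff n) : Fin (n + 2) → ℝ) i *
      replicaCoeff (n + 1) i' * pairKernel U d ρ i i' := by
  have h : ∀ i i', U (ρ i) (ρ i') = pairKernel U d ρ i i' + if i = i' then k else 0 := by
    intro i i'
    by_cases hi : i = i'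
    · subst hi; simp [pairKernel, hd, add_comm]
    · simp [pairKernel, hi]
  have h0 : ∑ i, (Fin.cons 0 (replicaCoeff n) : Fin (n + 2) → ℝ) i *
      replicaCoeff (n + 1) i * k = 0 := by
    simp [Fin.sum_univ_succ, replicaCoeff]
  simp only [derivFactor, h, mul_add, Finset.sum_add_distrib, mul_ite, mul_zero,
    Finset.sum_ite_eq, Finset.mem_univ, if_true, h0, add_zero]

lemma abs_derivFactor_le {n : ℕ} {U : S → S → ℝ} {d : S → ℝ} {k : ℝ} (hd : ∀ ρ, U ρ ρ = k + d ρ)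
    (ρ : Fin (n + 2) → S) :
    |derivFactor n U ρ| ≤ ((n + 1) * (n + 2)) * kernelSum U d ρ := by
  rw [derivFactor_eq hd, kernelSum, Finset.mul_sum]
  refine (Finset.abs_sum_le_sum_abs _ _).trans (Finset.sum_le_sum fun i _ => ?_)
  rw [Finset.mul_sum]
  refine (Finset.abs_sum_le_sum_abs _ _).trans (Finset.sum_le_sum fun i' _ => ?_)
  rw [abs_mul, abs_mul]
  have h1 : |(Fin.cons 0 (replicaCoeff n) : Fin (n + 2) → ℝ) i| ≤ n + 1 := by
    refine Fin.cases ?_ (fun i => ?_) i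
    · simp; positivity
    · simpa using abs_replicaCoeff_le n i
  have h2 : |replicaCoeff (n + 1) i'| ≤ n + 2 := by
    have := abs_replicaCoeff_le (n + 1) i'
    push_cast at this; linarith
  gcongr

/-- A function of `n` replicas seen as a function of `n + 2m` replicas. -/
def liftObs {n : ℕ} (f : (Fin n → S) → ℝ) : (m : ℕ) → (Fin (n + 2 * m) → S) → ℝ
  | 0 => f
  | m + 1 => fun ρ : Fin (n + 2 * m + 2) → S => liftObs f m (Fin.tail (Fin.tail ρ))

/-- The observable whose Gibbs average is the `m`-th derivative of `E⟨f⟩_s`. -/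
def iterObs {n : ℕ} (U : S → S → ℝ) (f : (Fin n → S) → ℝ) : (m : ℕ) → (Fin (n + 2 * m) → S) → ℝ
  | 0 => f
  | m + 1 => fun ρ : Fin (n + 2 * m + 2) → S =>
      iterObs U f m (Fin.tail (Fin.tail ρ)) * derivFactor (n + 2 * m) U ρ

/-- The combinatorial constant in the bound on `iterObs`. -/
def iterConst (n : ℕ) : ℕ → ℝ
  | 0 => 1
  | m + 1 => iterConst n m * (((n + 2 * m : ℕ) + 1) * ((n + 2 * m : ℕ) + 2))

lemma iterConst_nonneg (n m : ℕ) : 0 ≤ iterConst n m := by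
  induction m with
  | zero => exact zero_le_one
  | succ m ih => unfold iterConst; positivity

lemma liftObs_comp {n : ℕ} (f : (Fin n → S) → ℝ) (φ : ℝ → ℝ) (m : ℕ) (ρ : Fin (n + 2 * m) → S) :
    liftObs (fun ρ => φ (f ρ)) m ρ = φ (liftObs f m ρ) := by
  induction m with
  | zero => rfl
  | succ m ih => exact ih _

lemma abs_iterObs_le {n : ℕ} {U : S → S → ℝ} {d : S → ℝ} {k : ℝ} (hd : ∀ ρ, U ρ ρ = k + d ρ)
    (f : (Fin n → S) → ℝ) (m : ℕ) (ρ : Fin (n + 2 * m) → S) :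
    |iterObs U f m ρ| ≤ iterConst n m * (|liftObs f m ρ| * kernelSum U d ρ ^ m) := by
  induction m with
  | zero => simp [iterObs, liftObs, iterConst]
  | succ m ih =>
    have hρ : ∃ ρ' : Fin (n + 2 * m + 2) → S, ρ' = ρ := ⟨ρ, rfl⟩
    obtain ⟨ρ', hρ'⟩ := hρ
    have h1 := ih (Fin.tail (Fin.tail ρ'))
    have h2 := abs_derivFactor_le hd ρ'
    have h3 : kernelSum U d (Fin.tail (Fin.tail ρ')) ≤ kernelSum U d ρ' :=
      (kernelSum_tail_le U d _).trans (kernelSum_tail_le U d _)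
    have h4 := kernelSum_nonneg U d (Fin.tail (Fin.tail ρ'))
    have h5 := iterConst_nonneg n m
    have h6 := kernelSum_nonneg U d ρ'
    subst hρ'
    change |iterObs U f m (Fin.tail (Fin.tail ρ')) * derivFactor (n + 2 * m) U ρ'| ≤
      iterConst n m * (((n + 2 * m : ℕ) + 1) * ((n + 2 * m : ℕ) + 2)) *
        (|liftObs f m (Fin.tail (Fin.tail ρ'))| * kernelSum U d ρ' ^ (m + 1))
    rw [abs_mul]
    calc _ ≤ (iterConst n m * (|liftObs f m (Fin.tail (Fin.tail ρ'))| * kernelSum U d ρ' ^ m)) *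
          ((((n + 2 * m : ℕ) + 1) * ((n + 2 * m : ℕ) + 2)) * kernelSum U d ρ') := by
            refine mul_le_mul (h1.trans ?_) h2 (abs_nonneg _) (by positivity)
            gcongr
      _ = _ := by rw [pow_succ]; ring

variable [Fintype S] [Nonempty S]

lemma quenchedAvg_liftObs {n : ℕ} (c : J → S → ℝ) (f : (Fin n → S) → ℝ) (m : ℕ) :
    quenchedAvg (n + 2 * m) c (liftObs f m) = quenchedAvg n c f := by
  induction m with
  | zero => rfl
  | succ m ih =>
    rw [← ih, ← quenchedAvg_tail (n + 2 * m), ← quenchedAvg_tail (n + 2 * m + 1)]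
    rfl

lemma iteratedDeriv_quenchedAvg (n m : ℕ) {a b : J → S → ℝ} {U : S → S → ℝ}
    (hab : ∀ ρ ρ', ∑ j, a j ρ * b j ρ' = 0) (haa : ∀ ρ ρ', ∑ j, a j ρ * a j ρ' = 2 * U ρ ρ')
    (f : (Fin n → S) → ℝ) {s : ℝ} (hs : 0 < s) :
    iteratedDeriv m (fun v => quenchedAvg n (interpCoeff a b v) f) s =
      quenchedAvg (n + 2 * m) (interpCoeff a b s) (iterObs U f m) := by
  induction m generalizing s with
  | zero => simp only [iteratedDeriv_zero]; rfl
  | succ m ih =>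
    rw [iteratedDeriv_succ]
    have h : iteratedDeriv m (fun v => quenchedAvg n (interpCoeff a b v) f) =ᶠ[nhds s]
        fun v => quenchedAvg (n + 2 * m) (interpCoeff a b v) (iterObs U f m) := by
      filter_upwards [Ioi_mem_nhds hs] with v hv using ih hv
    rw [h.deriv_eq]
    exact (hasDerivAt_quenchedAvg (n + 2 * m) hab haa (iterObs U f m) hs).deriv

/-- Comparison of the interpolated averages at `s` and at `1`. -/
lemma quenchedAvg_le_exp_mul (n : ℕ) {a b : J → S → ℝ} {U : S → S → ℝ}
    (hab : ∀ ρ ρ', ∑ j, a j ρ * b j ρ' = 0) (haa : ∀ ρ ρ', ∑ j, a j ρ * a j ρ' = 2 * U ρ ρ')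
    {M : ℝ} (hM : 0 ≤ M) (hUM : ∀ ρ, |derivFactor n U ρ| ≤ M)
    {h : (Fin n → S) → ℝ} (hh : ∀ ρ, 0 ≤ h ρ) {s : ℝ} (hs : 0 < s) (hs1 : s ≤ 1) :
    quenchedAvg n (interpCoeff a b s) h ≤ exp M * quenchedAvg n (interpCoeff a b 1) h := by
  set φ : ℝ → ℝ := fun v => quenchedAvg n (interpCoeff a b v) h with hφ
  set φ' : ℝ → ℝ := fun v => quenchedAvg (n + 2) (interpCoeff a b v)
        (fun ρ => h (Fin.tail (Fin.tail ρ)) * derivFactor n U ρ) with hφ'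
  have hder : ∀ v, 0 < v → HasDerivAt φ (φ' v) v := fun v hv =>
    hasDerivAt_quenchedAvg n hab haa h hv
  have hlow : ∀ v, -(M * φ v) ≤ φ' v := fun v => by
    have h1 := quenchedAvg_mono (n + 2) (interpCoeff a b v)
      (f := fun ρ => -M * h (Fin.tail (Fin.tail ρ)))
      (g := fun ρ => h (Fin.tail (Fin.tail ρ)) * derivFactor n U ρ) fun ρ => by
        nlinarith [hh (Fin.tail (Fin.tail ρ)), (abs_le.1 (hUM ρ)).1]
    rw [quenchedAvg_const_mul, quenchedAvg_tail (n + 1) (interpCoeff a b v)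
      (fun ρ => h (Fin.tail ρ)), quenchedAvg_tail n] at h1
    linarith
  have hψ : ∀ v, 0 < v → HasDerivAt (fun v => exp (M * v) * φ v)
      (exp (M * v) * (M * φ v + φ' v)) v := fun v hv =>
    ((((hasDerivAt_id v).const_mul M).exp).mul (hder v hv)).congr_deriv (by simp; ring)
  have hmono : MonotoneOn (fun v => exp (M * v) * φ v) (Set.Icc s 1) := by
    refine monotoneOn_of_deriv_nonneg (convex_Icc s 1)
      (fun v hv => (hψ v (hs.trans_le hv.1)).continuousAt.continuousWithinAt)
      (fun v hv => (hψ v (hs.trans_le (interior_subset hv).1)).differentiableAt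
        |>.differentiableWithinAt) fun v hv => ?_
    rw [(hψ v (hs.trans_le (interior_subset hv).1)).deriv]
    exact mul_nonneg (exp_pos _).le (by linarith [hlow v])
  have h1 := hmono (Set.left_mem_Icc.2 hs1) (Set.right_mem_Icc.2 hs1) hs1
  simp only [mul_one] at h1
  refine le_trans ?_ h1
  exact le_mul_of_one_le_left (quenchedAvg_nonneg n _ hh) (one_le_exp (by positivity))

lemma quenchedAvg_eq_sum (n : ℕ) (c : J → S → ℝ) (f : (Fin n → S) → ℝ) :
    quenchedAvg n c f =
      ∑ ρ, f ρ * quenchedAvg n c (Set.indicator {ρ} fun _ => 1) := by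
  classical
  rw [← quenchedAvg_sum_mul]
  congr 1
  ext ρ
  simp [Set.indicator_apply]

/-- Hölder's inequality for the quenched average. -/
lemma quenchedAvg_mul_le (n : ℕ) (c : J → S → ℝ) {f g : (Fin n → S) → ℝ} (hf : ∀ ρ, 0 ≤ f ρ)
    (hg : ∀ ρ, 0 ≤ g ρ) {p q : ℝ} (hpq : p.HolderConjugate q) :
    quenchedAvg n c (fun ρ => f ρ * g ρ) ≤ quenchedAvg n c (fun ρ => f ρ ^ p) ^ (1 / p) *
      quenchedAvg n c (fun ρ => g ρ ^ q) ^ (1 / q) := by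
  simp only [quenchedAvg_eq_sum n c (fun ρ => f ρ * g ρ), quenchedAvg_eq_sum n c fun ρ => f ρ ^ p,
    quenchedAvg_eq_sum n c fun ρ => g ρ ^ q]
  set w : (Fin n → S) → ℝ := fun ρ => quenchedAvg n c (Set.indicator {ρ} fun _ => 1)
  have hw : ∀ ρ, 0 ≤ w ρ := fun ρ =>
    quenchedAvg_nonneg n c fun ρ' => Set.indicator_nonneg (fun _ _ => zero_le_one) _
  have hH := Real.inner_le_Lp_mul_Lq_of_nonneg univ (f := fun ρ => f ρ * w ρ ^ (1 / p))
    (g := fun ρ => g ρ * w ρ ^ (1 / q)) hpq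
    (fun ρ _ => mul_nonneg (hf ρ) (rpow_nonneg (hw ρ) _))
    (fun ρ _ => mul_nonneg (hg ρ) (rpow_nonneg (hw ρ) _))
  have hroot : ∀ {r : ℝ}, 0 < r → ∀ {y z : ℝ}, 0 ≤ y → 0 ≤ z →
      (y * z ^ (1 / r)) ^ r = y ^ r * z := by
    intro r hr y z hy hz
    rw [mul_rpow hy (rpow_nonneg hz _), ← rpow_mul hz, one_div_mul_cancel hr.ne', rpow_one]
  simp only [hroot hpq.pos (hf _) (hw _), hroot hpq.symm.pos (hg _) (hw _)] at hH
  refine le_of_eq_of_le (Finset.sum_congr rfl fun ρ _ => ?_) hH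
  rw [mul_mul_mul_comm, ← rpow_add' (hw ρ) (by rw [hpq.one_div_add_one_div]; norm_num),
    hpq.one_div_add_one_div]
  simp [w]

lemma quenchedAvg_kernelSum_pow_le {n p : ℕ} (hp : 1 ≤ p) (c : J → S → ℝ) {U : S → S → ℝ}
    {d : S → ℝ} {W : ℝ}
    (hW : ∀ i i' : Fin n, quenchedAvg n c (fun ρ => |pairKernel U d ρ i i'| ^ p) ≤ W) :
    quenchedAvg n c (fun ρ => kernelSum U d ρ ^ p) ≤ ((n : ℝ) ^ 2) ^ p * W := by
  obtain ⟨p, rfl⟩ : ∃ q, p = q + 1 := ⟨p - 1, by omega⟩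
  rcases Nat.eq_zero_or_pos n with rfl | hn
  · simpa [kernelSum] using (quenchedAvg_const_mul 0 c 0 (fun _ => 0)).le
  have hn' : (0 : ℝ) < n := by exact_mod_cast hn
  have hpt : ∀ ρ : Fin n → S, kernelSum U d ρ ^ (p + 1) ≤ ∑ z : Fin n × Fin n,
      ((n : ℝ) ^ 2) ^ p * |pairKernel U d ρ z.1 z.2| ^ (p + 1) := fun ρ => by
    have h := pow_sum_div_card_le_sum_pow (s := (univ : Finset (Fin n × Fin n)))
      (f := fun z => |pairKernel U d ρ z.1 z.2|) (fun _ _ => abs_nonneg _) p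
    rw [div_le_iff₀' (by simp; positivity), Finset.mul_sum, Fintype.sum_prod_type] at h
    simpa [kernelSum, ← sq] using h
  calc _ ≤ _ := quenchedAvg_mono n c hpt
    _ = ∑ z : Fin n × Fin n, ((n : ℝ) ^ 2) ^ p *
        quenchedAvg n c (fun ρ => |pairKernel U d ρ z.1 z.2| ^ (p + 1)) :=
      quenchedAvg_sum_mul _ n c _ _
    _ ≤ ∑ _z : Fin n × Fin n, ((n : ℝ) ^ 2) ^ p * W :=
      Finset.sum_le_sum fun z _ => mul_le_mul_of_nonneg_left (hW z.1 z.2) (by positivity)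
    _ = _ := by simp; ring

/-- The `m`-th derivative of the interpolated average is controlled by the moments of the kernel
at the end point of the interpolation. -/
theorem abs_iteratedDeriv_quenchedAvg_le (n m : ℕ) {a b : J → S → ℝ} {U : S → S → ℝ} {d : S → ℝ}
    {k M : ℝ} (hab : ∀ ρ ρ', ∑ j, a j ρ * b j ρ' = 0)
    (haa : ∀ ρ ρ', ∑ j, a j ρ * a j ρ' = 2 * U ρ ρ') (hd : ∀ ρ, U ρ ρ = k + d ρ)
    (hM : 0 ≤ M) (hUM : ∀ ρ, |derivFactor (n + 2 * m) U ρ| ≤ M)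
    (f : (Fin n → S) → ℝ) {s : ℝ} (hs : 0 < s) (hs1 : s ≤ 1) {r₁ r₂ : ℝ}
    (hr : r₁.HolderConjugate r₂) {p : ℕ} (hp : 1 ≤ p) (hmp : (m : ℝ) * r₂ = p) {W L : ℝ}
    (hW0 : 0 ≤ W) (hL0 : 0 ≤ L)
    (hW : ∀ i i' : Fin (n + 2 * m), quenchedAvg (n + 2 * m) (interpCoeff a b 1)
      (fun ρ => |pairKernel U d ρ i i'| ^ p) ≤ L ^ p * W) :
    |iteratedDeriv m (fun v => quenchedAvg n (interpCoeff a b v) f) s| ≤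
      (iterConst n m * exp M * (((n + 2 * m : ℕ) : ℝ) ^ 2 * L) ^ m) *
        quenchedAvg n (interpCoeff a b 1) (fun ρ => |f ρ| ^ r₁) ^ (1 / r₁) * W ^ (1 / r₂) := by
  rw [iteratedDeriv_quenchedAvg n m hab haa f hs]
  have hr1 := hr.pos
  have hr2 := hr.symm.pos
  have hC := iterConst_nonneg n m
  have hpow : ∀ ρ : Fin (n + 2 * m) → S,
      (kernelSum U d ρ ^ m) ^ r₂ = kernelSum U d ρ ^ p := fun ρ => by
    rw [← rpow_natCast, ← rpow_mul (kernelSum_nonneg U d ρ), hmp, rpow_natCast]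
  have hf : quenchedAvg (n + 2 * m) (interpCoeff a b s) (fun ρ => |liftObs f m ρ| ^ r₁) ≤
      exp M * quenchedAvg n (interpCoeff a b 1) (fun ρ => |f ρ| ^ r₁) := by
    refine (quenchedAvg_le_exp_mul _ hab haa hM hUM (fun ρ => by positivity) hs hs1).trans_eq ?_
    rw [← quenchedAvg_liftObs _ (fun ρ => |f ρ| ^ r₁) m]
    congr 2
    ext ρ
    exact (liftObs_comp f (fun y => |y| ^ r₁) m ρ).symm
  have hg : quenchedAvg (n + 2 * m) (interpCoeff a b s) (fun ρ => (kernelSum U d ρ ^ m) ^ r₂) ≤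
      exp M * (((((n + 2 * m : ℕ) : ℝ) ^ 2) * L) ^ p * W) := by
    simp only [hpow]
    refine (quenchedAvg_le_exp_mul _ hab haa hM hUM
      (fun ρ => pow_nonneg (kernelSum_nonneg U d ρ) p) hs hs1).trans ?_
    refine mul_le_mul_of_nonneg_left ?_ (exp_pos M).le
    rw [mul_pow, mul_assoc]
    exact quenchedAvg_kernelSum_pow_le hp _ hW
  set F := quenchedAvg n (interpCoeff a b 1) (fun ρ => |f ρ| ^ r₁)
  have hF : 0 ≤ F := quenchedAvg_nonneg _ _ fun ρ => by positivity
  set T : ℝ := ((n + 2 * m : ℕ) : ℝ) ^ 2 * L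
  have hT : 0 ≤ T := by positivity
  have hTp : (T ^ p) ^ (1 / r₂) = T ^ m := by
    rw [← rpow_natCast, ← hmp, ← rpow_mul hT, mul_assoc, mul_one_div_cancel hr2.ne', mul_one,
      rpow_natCast]
  have hexp : exp M ^ (1 / r₁) * exp M ^ (1 / r₂) = exp M := by
    rw [← rpow_add (exp_pos M), hr.one_div_add_one_div]; simp
  calc |quenchedAvg (n + 2 * m) (interpCoeff a b s) (iterObs U f m)|
      ≤ quenchedAvg (n + 2 * m) (interpCoeff a b s) fun ρ => |iterObs U f m ρ| :=
        abs_quenchedAvg_le _ _ _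
    _ ≤ iterConst n m * quenchedAvg (n + 2 * m) (interpCoeff a b s)
          fun ρ => |liftObs f m ρ| * kernelSum U d ρ ^ m := by
        rw [← quenchedAvg_const_mul]
        exact quenchedAvg_mono _ _ (abs_iterObs_le hd f m)
    _ ≤ iterConst n m * ((exp M * F) ^ (1 / r₁) * (exp M * (T ^ p * W)) ^ (1 / r₂)) := by
        refine mul_le_mul_of_nonneg_left ((quenchedAvg_mul_le _ _ (fun ρ => abs_nonneg _)
          (fun ρ => pow_nonneg (kernelSum_nonneg U d ρ) m) hr).trans ?_) hC
        refine mul_le_mul (rpow_le_rpow ?_ hf (by positivity)) (rpow_le_rpow ?_ hg (by positivity))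
          (rpow_nonneg ?_ _) (by positivity)
        · exact quenchedAvg_nonneg _ _ fun ρ => by positivity
        all_goals
          exact quenchedAvg_nonneg _ _ fun ρ =>
            rpow_nonneg (pow_nonneg (kernelSum_nonneg U d ρ) m) _
    _ = _ := by
        rw [mul_rpow (exp_pos M).le hF, mul_rpow (exp_pos M).le (by positivity),
          mul_rpow (by positivity) hW0, hTp]
        linear_combination (iterConst n m * F ^ (1 / r₁) * T ^ m * W ^ (1 / r₂)) * hexp

end IteratedDerivative

section Moments

variable {S A I : Type} [Fintype S] [Fintype A]

lemma replicaAvg_const [Nonempty S] (n : ℕ) (H : S → ℝ) (r : ℝ) :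
    replicaAvg n H (fun _ => r) = r := by
  induction n with
  | zero => simp [replicaAvg]
  | succ n ih => exact (replicaAvg_tail n H fun _ => r).trans ih

lemma replicaAvg_eval [Nonempty S] (n : ℕ) (H : S → ℝ) (g : S → ℝ) (i : Fin n) :
    replicaAvg n H (fun ρ => g (ρ i)) = ∑ ρ, g ρ * gibbsWeight H ρ := by
  induction n with
  | zero => exact i.elim0
  | succ n ih =>
    refine Fin.cases ?_ (fun i => ?_) i
    · simp [replicaAvg_succ, replicaAvg_const, mul_comm]
    · rw [← ih i]
      exact replicaAvg_tail n H fun ρ => g (ρ i)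

lemma replicaAvg_eval₂ [Nonempty S] (n : ℕ) (H : S → ℝ) (g : S → S → ℝ) {i i' : Fin n}
    (h : i ≠ i') : replicaAvg n H (fun ρ => g (ρ i) (ρ i')) =
      ∑ ρ, (∑ ρ', g ρ ρ' * gibbsWeight H ρ') * gibbsWeight H ρ := by
  induction n with
  | zero => exact i.elim0
  | succ n ih =>
    induction i using Fin.cases with
    | zero =>
      induction i' using Fin.cases with
      | zero => exact absurd rfl h
      | succ i' =>
        rw [replicaAvg_succ]
        refine Finset.sum_congr rfl fun ρ _ => ?_
        simp only [Fin.cons_zero, Fin.cons_succ]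
        rw [replicaAvg_eval n H (g ρ), mul_comm]
    | succ i =>
      induction i' using Fin.cases with
      | zero =>
        rw [replicaAvg_succ]
        simp only [Fin.cons_zero, Fin.cons_succ]
        simp only [fun ρ₀ => replicaAvg_eval n H (fun ρ => g ρ ρ₀) i, Finset.sum_mul,
          Finset.mul_sum]
        rw [Finset.sum_comm]
        exact Finset.sum_congr rfl fun _ _ => Finset.sum_congr rfl fun _ _ => by ring
      | succ i' =>
        rw [← ih fun h' => h (congrArg Fin.succ h')]
        exact replicaAvg_tail n H fun ρ => g (ρ i) (ρ i')

lemma gibbsWeight_add (H₁ H₂ : A → ℝ) (ρ : A × A) :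
    gibbsWeight (fun ρ : A × A => H₁ ρ.1 + H₂ ρ.2) ρ = gibbsWeight H₁ ρ.1 * gibbsWeight H₂ ρ.2 := by
  simp only [gibbsWeight, exp_add, Fintype.sum_prod_type, ← Finset.sum_mul_sum]
  rw [div_mul_div_comm]

/-- The average of `h` over two independent spins with weights `q` and `q'`. -/
def pairAvg (h : A → A → ℝ) (q q' : A → ℝ) : ℝ := ∑ σ, (∑ τ, h σ τ * q' τ) * q σ

lemma sum_fst_mul_gibbsWeight [Nonempty A] (H₁ H₂ : A → ℝ) (g : A → ℝ) :
    ∑ ρ : A × A, g ρ.1 * gibbsWeight (fun ρ : A × A => H₁ ρ.1 + H₂ ρ.2) ρ =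
      ∑ σ, g σ * gibbsWeight H₁ σ := by
  simp only [gibbsWeight_add, Fintype.sum_prod_type, ← Finset.mul_sum, sum_gibbsWeight, mul_one]

lemma sum_snd_mul_gibbsWeight [Nonempty A] (H₁ H₂ : A → ℝ) (g : A → ℝ) :
    ∑ ρ : A × A, g ρ.2 * gibbsWeight (fun ρ : A × A => H₁ ρ.1 + H₂ ρ.2) ρ =
      ∑ τ, g τ * gibbsWeight H₂ τ := by
  rw [Fintype.sum_prod_type, Finset.sum_comm]
  simp only [gibbsWeight_add, mul_left_comm _ (gibbsWeight H₁ _), ← Finset.sum_mul,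
    sum_gibbsWeight, one_mul]

lemma pairAvg_pow_eq (x : A → I → ℝ) (J : Finset I) (p : ℕ) (q q' : A → ℝ) :
    pairAvg (fun σ τ => (∑ i ∈ J, x σ i * x τ i) ^ p) q q' =
      ∑ v ∈ Fintype.piFinset fun _ : Fin p => J,
        (∑ σ, (∏ l, x σ (v l)) * q σ) * ∑ τ, (∏ l, x τ (v l)) * q' τ := by
  simp only [pairAvg, Finset.sum_pow', Finset.prod_mul_distrib, Finset.sum_mul_sum]
  simp only [Finset.sum_mul]
  symm
  rw [Finset.sum_comm]
  refine Finset.sum_congr rfl fun σ _ => ?_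
  rw [Finset.sum_comm]
  exact Finset.sum_congr rfl fun τ _ => Finset.sum_congr rfl fun v _ => by ring

lemma pairAvg_pow_le (x : A → I → ℝ) (J : Finset I) (p : ℕ) (q q' : A → ℝ) :
    pairAvg (fun σ τ => (∑ i ∈ J, x σ i * x τ i) ^ p) q q' ≤
      (pairAvg (fun σ τ => (∑ i ∈ J, x σ i * x τ i) ^ p) q q +
        pairAvg (fun σ τ => (∑ i ∈ J, x σ i * x τ i) ^ p) q' q') / 2 := by
  simp only [pairAvg_pow_eq, ← Finset.sum_add_distrib, Finset.sum_div]
  refine Finset.sum_le_sum fun v _ => ?_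
  nlinarith [sq_nonneg ((∑ σ, (∏ l, x σ (v l)) * q σ) - ∑ τ, (∏ l, x τ (v l)) * q' τ)]

lemma pairAvg_pow_mono (x : A → I → ℝ) {J J' : Finset I} (h : J ⊆ J') (p : ℕ) (q : A → ℝ) :
    pairAvg (fun σ τ => (∑ i ∈ J, x σ i * x τ i) ^ p) q q ≤
      pairAvg (fun σ τ => (∑ i ∈ J', x σ i * x τ i) ^ p) q q := by
  simp only [pairAvg_pow_eq]
  exact Finset.sum_le_sum_of_subset_of_nonneg (Fintype.piFinset_subset _ _ fun _ => h)
    fun v _ _ => mul_self_nonneg _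

lemma ovlp_eq_sum (N : ℕ) (σ τ : Config N) :
    ovlp N σ τ = ∑ i, spin (σ i) / √N * (spin (τ i) / √N) := by
  simp only [ovlp, Finset.sum_div, div_mul_div_comm, mul_self_sqrt N.cast_nonneg]

lemma ovlpm_eq_sum (N : ℕ) (σ τ : Config N) :
    ovlpm N σ τ = ∑ i ∈ univ.filter (fun i : Fin N => (i : ℕ) < N - 1),
      spin (σ i) / √N * (spin (τ i) / √N) := by
  simp only [ovlpm, Finset.sum_div, div_mul_div_comm, mul_self_sqrt N.cast_nonneg]

/-- For even `p`, mixed moments of the truncated overlap are dominated by moments of the overlap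
within each of the two systems. -/
lemma pairAvg_abs_ovlpm_pow_le (N : ℕ) {p : ℕ} (hp : Even p) (q q' : Config N → ℝ) :
    pairAvg (fun σ τ => |ovlpm N σ τ| ^ p) q q' ≤
      (pairAvg (fun σ τ => |ovlp N σ τ| ^ p) q q +
        pairAvg (fun σ τ => |ovlp N σ τ| ^ p) q' q') / 2 := by
  simp only [hp.pow_abs, ovlp_eq_sum, ovlpm_eq_sum]
  refine (pairAvg_pow_le (fun (σ : Config N) i => spin (σ i) / √N) _ p q q').trans ?_
  have h := fun q => pairAvg_pow_mono (fun (σ : Config N) i => spin (σ i) / √N)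
    (Finset.filter_subset (fun i : Fin N => (i : ℕ) < N - 1) univ) p q
  linarith [h q, h q']

end Moments

section Overlap

variable {N : ℕ}

lemma spin_mul_self (b : Bool) : spin b * spin b = 1 := by
  cases b <;> simp [spin]

lemma abs_spin (b : Bool) : |spin b| = 1 := by
  cases b <;> simp [spin]

lemma abs_spinLast_le (σ : Config N) : |spinLast σ| ≤ 1 := by
  unfold spinLast
  split_ifs
  · rw [abs_spin]
  · simp

lemma abs_spinLast_mul_le (σ τ : Config N) (r : ℝ) : |spinLast σ * spinLast τ * r| ≤ |r| := by
  rw [abs_mul, abs_mul]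
  exact mul_le_of_le_one_left (abs_nonneg r)
    (mul_le_one₀ (abs_spinLast_le σ) (abs_nonneg _) (abs_spinLast_le τ))

lemma abs_ovlpm_le_one (σ τ : Config N) : |ovlpm N σ τ| ≤ 1 := by
  rw [ovlpm, abs_div, Nat.abs_cast]
  refine div_le_one_of_le₀ ((Finset.abs_sum_le_sum_abs _ _).trans ?_) N.cast_nonneg
  simp only [abs_mul, abs_spin, mul_one, Finset.sum_const, nsmul_eq_mul]
  exact_mod_cast (Finset.card_le_univ _).trans_eq (Fintype.card_fin N)

lemma ovlpm_comm (σ τ : Config N) : ovlpm N σ τ = ovlpm N τ σ := by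
  simp only [ovlpm, mul_comm]

/-- The fluctuating part of the diagonal of `Ufun`. -/
def Udiag (N : ℕ) (β t : ℝ) (ρ : Config N × Config N) : ℝ :=
  β ^ 2 * t * (spinLast ρ.1 * spinLast ρ.2 * ovlpm N ρ.1 ρ.2)

lemma Ufun_self (hN : 0 < N) (β t : ℝ) (ρ : Config N × Config N) :
    Ufun N β t ρ ρ =
      β ^ 2 * (#(univ.filter fun i : Fin N => (i : ℕ) < N - 1) / N) + Udiag N β t ρ := by
  have hs : ∀ σ : Config N, spinLast σ * spinLast σ = 1 := fun σ => by
    rw [spinLast, dif_pos hN, spin_mul_self]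
  have ho : ∀ σ : Config N, ovlpm N σ σ = #(univ.filter fun i : Fin N => (i : ℕ) < N - 1) / N :=
    fun σ => by simp [ovlpm, spin_mul_self]
  rw [Ufun, Udiag, hs, hs, ho, ho, ovlpm_comm ρ.2 ρ.1]
  ring

variable {β t : ℝ}

lemma abs_Udiag_le (hβ : β ∈ Set.Icc (0 : ℝ) 1) (ht : t ∈ Set.Icc (0 : ℝ) 1)
    (ρ : Config N × Config N) : |Udiag N β t ρ| ≤ |ovlpm N ρ.1 ρ.2| := by
  rw [Udiag, abs_mul]
  refine (mul_le_of_le_one_left (abs_nonneg _) ?_).trans (abs_spinLast_mul_le _ _ _)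
  rw [abs_of_nonneg (mul_nonneg (sq_nonneg β) ht.1)]
  exact mul_le_one₀ (pow_le_one₀ hβ.1 hβ.2) ht.1 ht.2

lemma abs_Ufun_le (hβ : β ∈ Set.Icc (0 : ℝ) 1) (ht : t ∈ Set.Icc (0 : ℝ) 1)
    (ρ ρ' : Config N × Config N) :
    |Ufun N β t ρ ρ'| ≤ (|ovlpm N ρ.1 ρ'.1| + |ovlpm N ρ.2 ρ'.2| + |ovlpm N ρ.1 ρ'.2| +
      |ovlpm N ρ.2 ρ'.1|) / 2 := by
  have h1 : |β ^ 2 / 2| ≤ 1 / 2 := by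
    rw [abs_of_nonneg (by positivity)]
    linarith [pow_le_one₀ (n := 2) hβ.1 hβ.2]
  have h2 : |β ^ 2 * t / 2| ≤ 1 / 2 := by
    rw [abs_of_nonneg (div_nonneg (mul_nonneg (sq_nonneg β) ht.1) two_pos.le)]
    linarith [mul_le_one₀ (pow_le_one₀ (n := 2) hβ.1 hβ.2) ht.1 ht.2]
  have h : ∀ σ τ σ' τ' : Config N, |spinLast σ * spinLast τ * ovlpm N σ τ +
      spinLast σ' * spinLast τ' * ovlpm N σ' τ'| ≤ |ovlpm N σ τ| + |ovlpm N σ' τ'| :=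
    fun σ τ σ' τ' => (abs_add_le _ _).trans
      (add_le_add (abs_spinLast_mul_le _ _ _) (abs_spinLast_mul_le _ _ _))
  unfold Ufun
  refine (abs_add_le _ _).trans ?_
  rw [abs_mul (β ^ 2 / 2), abs_mul (β ^ 2 * t / 2)]
  refine (add_le_add (mul_le_mul h1 (h _ _ _ _) (abs_nonneg _) (by norm_num))
    (mul_le_mul h2 (h _ _ _ _) (abs_nonneg _) (by norm_num))).trans_eq ?_
  ring

lemma abs_Ufun_le_two (hβ : β ∈ Set.Icc (0 : ℝ) 1) (ht : t ∈ Set.Icc (0 : ℝ) 1)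
    (ρ ρ' : Config N × Config N) : |Ufun N β t ρ ρ'| ≤ 2 := by
  have h := abs_ovlpm_le_one (N := N)
  linarith [abs_Ufun_le hβ ht ρ ρ', h ρ.1 ρ'.1, h ρ.2 ρ'.2, h ρ.1 ρ'.2, h ρ.2 ρ'.1]

lemma abs_Ufun_pow_le (hβ : β ∈ Set.Icc (0 : ℝ) 1) (ht : t ∈ Set.Icc (0 : ℝ) 1)
    (p : ℕ) (ρ ρ' : Config N × Config N) :
    |Ufun N β t ρ ρ'| ^ p ≤ 2 ^ p / 4 * (|ovlpm N ρ.1 ρ'.1| ^ p + |ovlpm N ρ.2 ρ'.2| ^ p +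
      |ovlpm N ρ.1 ρ'.2| ^ p + |ovlpm N ρ.2 ρ'.1| ^ p) := by
  have h := pow_arith_mean_le_arith_mean_pow univ (fun _ : Fin 4 => (1 / 4 : ℝ))
    ![|ovlpm N ρ.1 ρ'.1|, |ovlpm N ρ.2 ρ'.2|, |ovlpm N ρ.1 ρ'.2|, |ovlpm N ρ.2 ρ'.1|]
    (fun _ _ => by norm_num) (by simp) (fun i _ => by fin_cases i <;> simp) p
  simp only [Fin.sum_univ_four, Matrix.cons_val] at h
  calc |Ufun N β t ρ ρ'| ^ p ≤ ((|ovlpm N ρ.1 ρ'.1| + |ovlpm N ρ.2 ρ'.2| + |ovlpm N ρ.1 ρ'.2| +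
        |ovlpm N ρ.2 ρ'.1|) / 2) ^ p := pow_le_pow_left₀ (abs_nonneg _) (abs_Ufun_le hβ ht ρ ρ') p
    _ = 2 ^ p * (1 / 4 * |ovlpm N ρ.1 ρ'.1| + 1 / 4 * |ovlpm N ρ.2 ρ'.2| +
        1 / 4 * |ovlpm N ρ.1 ρ'.2| + 1 / 4 * |ovlpm N ρ.2 ρ'.1|) ^ p := by
      rw [← mul_pow]; congr 1; ring
    _ ≤ _ := mul_le_mul_of_nonneg_left h (by positivity)
    _ = _ := by ring

lemma replicaAvg_pairKernel_pow_le (hβ : β ∈ Set.Icc (0 : ℝ) 1) (ht : t ∈ Set.Icc (0 : ℝ) 1)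
    {n p : ℕ} (hp : Even p) (H₁ H₂ : Config N → ℝ) (i i' : Fin n) :
    replicaAvg n (fun ρ : Config N × Config N => H₁ ρ.1 + H₂ ρ.2)
        (fun ρ => |pairKernel (Ufun N β t) (Udiag N β t) ρ i i'| ^ p) ≤
      2 ^ p * ((pairAvg (fun σ τ => |ovlp N σ τ| ^ p) (gibbsWeight H₁) (gibbsWeight H₁) +
        pairAvg (fun σ τ => |ovlp N σ τ| ^ p) (gibbsWeight H₂) (gibbsWeight H₂)) / 2) := by
  have hR := pairAvg_abs_ovlpm_pow_le N hp
  have hw := gibbsWeight_nonneg (fun ρ : Config N × Config N => H₁ ρ.1 + H₂ ρ.2)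
  by_cases h : i = i'
  · simp only [pairKernel, if_pos h]
    rw [replicaAvg_eval n _ (fun ρ => |Udiag N β t ρ| ^ p) i]
    have h12 := hR (gibbsWeight H₁) (gibbsWeight H₂)
    calc _ ≤ ∑ ρ : Config N × Config N, |ovlpm N ρ.1 ρ.2| ^ p *
          gibbsWeight (fun ρ : Config N × Config N => H₁ ρ.1 + H₂ ρ.2) ρ :=
          Finset.sum_le_sum fun ρ _ => mul_le_mul_of_nonneg_right
            (pow_le_pow_left₀ (abs_nonneg _) (abs_Udiag_le hβ ht ρ) p) (hw ρ)
      _ = pairAvg (fun σ τ => |ovlpm N σ τ| ^ p) (gibbsWeight H₁) (gibbsWeight H₂) := by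
        simp only [gibbsWeight_add, Fintype.sum_prod_type, pairAvg, Finset.sum_mul]
        exact Finset.sum_congr rfl fun _ _ => Finset.sum_congr rfl fun _ _ => by ring
      _ ≤ _ := h12
      _ ≤ _ := by
        refine le_mul_of_one_le_left (h12.trans' ?_) (one_le_pow₀ one_le_two)
        exact Finset.sum_nonneg fun σ _ => mul_nonneg (Finset.sum_nonneg fun τ _ =>
          mul_nonneg (by positivity) (gibbsWeight_nonneg _ _)) (gibbsWeight_nonneg _ _)
  · simp only [pairKernel, if_neg h]
    rw [replicaAvg_eval₂ n _ (fun ρ ρ' => |Ufun N β t ρ ρ'| ^ p) h]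
    calc _ ≤ ∑ ρ, (∑ ρ', 2 ^ p / 4 * (|ovlpm N ρ.1 ρ'.1| ^ p + |ovlpm N ρ.2 ρ'.2| ^ p +
            |ovlpm N ρ.1 ρ'.2| ^ p + |ovlpm N ρ.2 ρ'.1| ^ p) *
            gibbsWeight (fun ρ : Config N × Config N => H₁ ρ.1 + H₂ ρ.2) ρ') *
            gibbsWeight (fun ρ : Config N × Config N => H₁ ρ.1 + H₂ ρ.2) ρ :=
          Finset.sum_le_sum fun ρ _ => mul_le_mul_of_nonneg_right (Finset.sum_le_sum fun ρ' _ =>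
            mul_le_mul_of_nonneg_right (abs_Ufun_pow_le hβ ht p ρ ρ') (hw ρ')) (hw ρ)
      _ = 2 ^ p / 4 *
          (pairAvg (fun σ τ => |ovlpm N σ τ| ^ p) (gibbsWeight H₁) (gibbsWeight H₁) +
          pairAvg (fun σ τ => |ovlpm N σ τ| ^ p) (gibbsWeight H₂) (gibbsWeight H₂) +
          pairAvg (fun σ τ => |ovlpm N σ τ| ^ p) (gibbsWeight H₁) (gibbsWeight H₂) +
          pairAvg (fun σ τ => |ovlpm N σ τ| ^ p) (gibbsWeight H₂) (gibbsWeight H₁)) := by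
        have h1 := fun σ => sum_fst_mul_gibbsWeight H₁ H₂ fun τ => |ovlpm N σ τ| ^ p
        have h2 := fun σ => sum_snd_mul_gibbsWeight H₁ H₂ fun τ => |ovlpm N σ τ| ^ p
        simp only [mul_assoc, ← Finset.mul_sum, add_mul, Finset.sum_add_distrib, h1, h2]
        congr 1
        simp only [pairAvg]
        rw [← sum_fst_mul_gibbsWeight H₁ H₂, ← sum_fst_mul_gibbsWeight H₁ H₂,
          ← sum_snd_mul_gibbsWeight H₁ H₂, ← sum_snd_mul_gibbsWeight H₁ H₂]
      _ ≤ _ := by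
        have := hR (gibbsWeight H₁) (gibbsWeight H₁)
        have := hR (gibbsWeight H₂) (gibbsWeight H₂)
        have := hR (gibbsWeight H₁) (gibbsWeight H₂)
        have := hR (gibbsWeight H₂) (gibbsWeight H₁)
        rw [div_mul_eq_mul_div, mul_div_assoc]
        refine mul_le_mul_of_nonneg_left ?_ (by positivity)
        linarith

end Overlap

section Coefficients

variable {N : ℕ}

/-- The coefficient of `g_{ij}` in the cavity Hamiltonian. -/
def bulkCoeff (N : ℕ) (β : ℝ) (p : Fin N × Fin N) (σ : Config N) : ℝ :=
  if p.1 < p.2 ∧ (p.2 : ℕ) < N - 1 then β / √N * (spin (σ p.1) * spin (σ p.2)) else 0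

/-- The coefficient of `g_{ij}` in the part of the Hamiltonian involving the last spin. -/
def cavCoeff (N : ℕ) (β : ℝ) (p : Fin N × Fin N) (σ : Config N) : ℝ :=
  if (p.1 : ℕ) < N - 1 ∧ (p.2 : ℕ) = N - 1 then β / √N * (spin (σ p.1) * spin (σ p.2)) else 0

lemma sum_last_column (hN : 0 < N) (F : Fin N × Fin N → ℝ) :
    (∑ p : Fin N × Fin N, if (p.1 : ℕ) < N - 1 ∧ (p.2 : ℕ) = N - 1 then F p else 0) =
      ∑ i ∈ univ.filter (fun i : Fin N => (i : ℕ) < N - 1),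
        F (i, ⟨N - 1, Nat.sub_lt hN Nat.one_pos⟩) := by
  rw [Fintype.sum_prod_type, Finset.sum_filter]
  refine Finset.sum_congr rfl fun i _ => ?_
  rw [Finset.sum_eq_single ⟨N - 1, Nat.sub_lt hN Nat.one_pos⟩]
  · simp
  · intro j _ hj
    exact if_neg fun h => hj (Fin.ext h.2)
  · simp

lemma cavCoeff_mul_bulkCoeff (β : ℝ) (p : Fin N × Fin N) (σ σ' : Config N) :
    cavCoeff N β p σ * bulkCoeff N β p σ' = 0 := by
  unfold cavCoeff bulkCoeff
  split_ifs <;> first | omega | simp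

lemma sum_cavCoeff_mul (hN : 0 < N) (β : ℝ) (σ σ' : Config N) :
    ∑ p, cavCoeff N β p σ * cavCoeff N β p σ' =
      β ^ 2 * (spinLast σ * spinLast σ' * ovlpm N σ σ') := by
  simp only [cavCoeff, ite_mul_ite, mul_zero]
  rw [sum_last_column hN, ovlpm, spinLast, spinLast, dif_pos hN, dif_pos hN, Finset.sum_div,
    Finset.mul_sum, Finset.mul_sum]
  refine Finset.sum_congr rfl fun i _ => ?_
  have h : ∀ y : ℝ, y / N = y / √N / √N := fun y => by
    rw [div_div, mul_self_sqrt N.cast_nonneg]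
  rw [h]
  ring

lemma linEnergy_bulkCoeff (β : ℝ) (g : Fin N × Fin N → ℝ) (σ : Config N) :
    linEnergy (bulkCoeff N β) g σ = hamCav N β g σ := by
  rw [linEnergy, hamCav, Finset.mul_sum, Finset.sum_filter]
  refine Finset.sum_congr rfl fun p _ => ?_
  rw [bulkCoeff]
  split_ifs <;> ring

lemma linEnergy_cavCoeff (hN : 0 < N) (β t : ℝ) (g g' : Fin N × Fin N → ℝ) (σ : Config N) :
    linEnergy (cavCoeff N β) (√t • g + √(1 - t) • g') σ = cavField N β t g g' σ := by
  simp only [linEnergy, cavCoeff, ite_mul, zero_mul]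
  rw [sum_last_column hN, cavField, dif_pos hN, Finset.mul_sum]
  exact Finset.sum_congr rfl fun i _ => by simp; ring

lemma linEnergy_interpCoeff {S J : Type} [Fintype J] (a b : J → S → ℝ) (s : ℝ) (x : J → ℝ) (ρ : S) :
    linEnergy (interpCoeff a b s) x ρ = linEnergy b x ρ + √s * linEnergy a x ρ := by
  simp only [linEnergy, interpCoeff, add_mul, Finset.sum_add_distrib, Finset.mul_sum, mul_assoc]

lemma linEnergy_add_smul {S J : Type} [Fintype J] (c : J → S → ℝ) (r r' : ℝ) (x x' : J → ℝ)
    (ρ : S) :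
    linEnergy c (r • x + r' • x') ρ = r * linEnergy c x ρ + r' * linEnergy c x' ρ := by
  simp only [linEnergy, Finset.mul_sum, ← Finset.sum_add_distrib]
  exact Finset.sum_congr rfl fun j _ => by simp; ring

lemma linEnergy_eq_hamTS (hN : 0 < N) (β t s : ℝ) (g g' : Fin N × Fin N → ℝ) (σ : Config N) :
    linEnergy (interpCoeff (cavCoeff N β) (bulkCoeff N β) s) (√t • g + √(1 - t) • g') σ =
      hamTS N β t s g g' σ := by
  rw [linEnergy_interpCoeff, linEnergy_cavCoeff hN, linEnergy_add_smul, linEnergy_bulkCoeff,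
    linEnergy_bulkCoeff, hamTS]

lemma linEnergy_eq_ham (β : ℝ) (g : Fin N × Fin N → ℝ) (σ : Config N) :
    linEnergy (interpCoeff (cavCoeff N β) (bulkCoeff N β) 1) g σ = ham N β g σ := by
  rw [linEnergy, ham, Finset.mul_sum, Finset.sum_filter]
  refine Finset.sum_congr rfl fun p _ => ?_
  have h2 := p.2.isLt
  simp only [interpCoeff, bulkCoeff, cavCoeff, sqrt_one, one_mul, Fin.lt_def]
  split_ifs <;> first | omega | ring

/-- The coefficients, with respect to three independent disorders, of the energy of two systems
with energy coefficients `c` and correlation `t` between their disorders. -/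
def coupledCoeff {S J : Type} (t : ℝ) (c : J → S → ℝ) : J ⊕ J ⊕ J → S × S → ℝ :=
  Sum.elim (fun j ρ => √t * (c j ρ.1 + c j ρ.2))
    (Sum.elim (fun j ρ => √(1 - t) * c j ρ.1) fun j ρ => √(1 - t) * c j ρ.2)

lemma interpCoeff_coupledCoeff {S J : Type} (t s : ℝ) (a b : J → S → ℝ) :
    interpCoeff (coupledCoeff t a) (coupledCoeff t b) s = coupledCoeff t (interpCoeff a b s) := by
  funext j ρ
  rcases j with j | j | j <;> simp [interpCoeff, coupledCoeff] <;> ring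

variable {S J : Type} [Fintype J]

lemma linEnergy_coupledCoeff (t : ℝ) (c : J → S → ℝ) (x : J ⊕ J ⊕ J → ℝ) (ρ : S × S) :
    linEnergy (coupledCoeff t c) x ρ =
      linEnergy c (√t • (x ∘ Sum.inl) + √(1 - t) • (x ∘ Sum.inr ∘ Sum.inl)) ρ.1 +
        linEnergy c (√t • (x ∘ Sum.inl) + √(1 - t) • (x ∘ Sum.inr ∘ Sum.inr)) ρ.2 := by
  simp only [linEnergy, coupledCoeff, Fintype.sum_sum_type, Sum.elim_inl, Sum.elim_inr,
    ← Finset.sum_add_distrib]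
  exact Finset.sum_congr rfl fun j _ => by simp; ring

lemma sum_coupledCoeff_mul {t : ℝ} (ht : t ∈ Set.Icc (0 : ℝ) 1) (a b : J → S → ℝ) (ρ ρ' : S × S) :
    ∑ j, coupledCoeff t a j ρ * coupledCoeff t b j ρ' =
      ∑ j, a j ρ.1 * b j ρ'.1 + ∑ j, a j ρ.2 * b j ρ'.2 +
        t * (∑ j, a j ρ.1 * b j ρ'.2 + ∑ j, a j ρ.2 * b j ρ'.1) := by
  have h : √t * √t = t := mul_self_sqrt ht.1
  have h' : √(1 - t) * √(1 - t) = 1 - t := mul_self_sqrt (sub_nonneg.2 ht.2)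
  simp only [coupledCoeff, Fintype.sum_sum_type, Sum.elim_inl, Sum.elim_inr, Finset.mul_sum,
    ← Finset.sum_add_distrib]
  refine Finset.sum_congr rfl fun j _ => ?_
  linear_combination (a j ρ.1 + a j ρ.2) * (b j ρ'.1 + b j ρ'.2) * h +
    (a j ρ.1 * b j ρ'.1 + a j ρ.2 * b j ρ'.2) * h'

end Coefficients

section Law

lemma measurePreserving_stdGauss_sum (J J' : Type) [Fintype J] [Fintype J'] :
    MeasurePreserving (fun x : J ⊕ J' → ℝ => (x ∘ Sum.inl, x ∘ Sum.inr)) (stdGauss (J ⊕ J'))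
      ((stdGauss J).prod (stdGauss J')) :=
  measurePreserving_sumPiEquivProdPi fun _ : J ⊕ J' => gaussianReal 0 1

lemma measurePreserving_stdGauss_three (J : Type) [Fintype J] :
    MeasurePreserving
      (fun x : J ⊕ J ⊕ J → ℝ => (x ∘ Sum.inl, x ∘ Sum.inr ∘ Sum.inl, x ∘ Sum.inr ∘ Sum.inr))
      (stdGauss (J ⊕ J ⊕ J)) ((stdGauss J).prod ((stdGauss J).prod (stdGauss J))) :=
  ((MeasurePreserving.id _).prod (measurePreserving_stdGauss_sum J J)).comp
    (measurePreserving_stdGauss_sum J (J ⊕ J))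

lemma measurePreserving_gaussianReal_rotate {t : ℝ} (ht : t ∈ Set.Icc (0 : ℝ) 1) :
    MeasurePreserving (fun y : ℝ × ℝ => √t * y.1 + √(1 - t) * y.2)
      ((gaussianReal 0 1).prod (gaussianReal 0 1)) (gaussianReal 0 1) := by
  refine ⟨by fun_prop, ?_⟩
  have h : (fun y : ℝ × ℝ => √t * y.1 + √(1 - t) * y.2) =
      (fun y : ℝ × ℝ => y.1 + y.2) ∘ Prod.map (√t * ·) (√(1 - t) * ·) := rfl
  rw [h, ← Measure.map_map (by fun_prop) (by fun_prop),
    ← Measure.map_prod_map _ _ (by fun_prop) (by fun_prop), gaussianReal_map_const_mul,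
    gaussianReal_map_const_mul]
  change Measure.conv _ _ = _
  rw [gaussianReal_conv_gaussianReal]
  congr 1
  · simp
  · ext
    simp [sq_sqrt ht.1, sq_sqrt (sub_nonneg.2 ht.2)]

lemma measurePreserving_stdGauss_rotate {t : ℝ} (ht : t ∈ Set.Icc (0 : ℝ) 1) (J : Type)
    [Fintype J] :
    MeasurePreserving (fun y : (J → ℝ) × (J → ℝ) => √t • y.1 + √(1 - t) • y.2)
      ((stdGauss J).prod (stdGauss J)) (stdGauss J) :=
  (measurePreserving_pi (fun _ : J => (gaussianReal 0 1).prod (gaussianReal 0 1))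
    (fun _ : J => gaussianReal 0 1) fun _ => measurePreserving_gaussianReal_rotate ht).comp
    (measurePreserving_arrowProdEquivProdArrow ℝ ℝ J (fun _ => gaussianReal 0 1)
      fun _ => gaussianReal 0 1).symm

lemma measurePreserving_rotate_fst {t : ℝ} (ht : t ∈ Set.Icc (0 : ℝ) 1) (J : Type) [Fintype J] :
    MeasurePreserving
      (fun x : J ⊕ J ⊕ J → ℝ => √t • (x ∘ Sum.inl) + √(1 - t) • (x ∘ Sum.inr ∘ Sum.inl))
      (stdGauss (J ⊕ J ⊕ J)) (stdGauss J) :=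
  (measurePreserving_stdGauss_rotate ht J).comp
    (((MeasurePreserving.id _).prod measurePreserving_fst).comp
      (measurePreserving_stdGauss_three J))

lemma measurePreserving_rotate_snd {t : ℝ} (ht : t ∈ Set.Icc (0 : ℝ) 1) (J : Type) [Fintype J] :
    MeasurePreserving
      (fun x : J ⊕ J ⊕ J → ℝ => √t • (x ∘ Sum.inl) + √(1 - t) • (x ∘ Sum.inr ∘ Sum.inr))
      (stdGauss (J ⊕ J ⊕ J)) (stdGauss J) :=
  (measurePreserving_stdGauss_rotate ht J).comp
    (((MeasurePreserving.id _).prod measurePreserving_snd).comp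
      (measurePreserving_stdGauss_three J))

end Law

section Cavity

variable {N : ℕ}

lemma gibbsTSn_eq_replicaAvg (hN : 0 < N) (β t s : ℝ) (g g' g'' : Fin N × Fin N → ℝ) {n : ℕ}
    (f : (Fin n → Config N × Config N) → ℝ) :
    gibbsTSn N β t s g g' g'' f = replicaAvg n (fun ρ =>
      linEnergy (interpCoeff (cavCoeff N β) (bulkCoeff N β) s) (√t • g + √(1 - t) • g') ρ.1 +
      linEnergy (interpCoeff (cavCoeff N β) (bulkCoeff N β) s) (√t • g + √(1 - t) • g'') ρ.2)
        f := by
  simp only [linEnergy_eq_hamTS hN, gibbsTSn, replicaAvg, gibbsWeight, wTS, Finset.prod_div_distrib,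
    Finset.prod_const, Finset.card_univ, Fintype.card_fin, Finset.sum_div, mul_div_assoc]

lemma EgibbsTSn_eq_quenchedAvg (hN : 0 < N) (β t s : ℝ) {n : ℕ}
    (f : (Fin n → Config N × Config N) → ℝ) :
    EgibbsTSn N β t s f = quenchedAvg n (interpCoeff (coupledCoeff t (cavCoeff N β))
      (coupledCoeff t (bulkCoeff N β)) s) f := by
  have hlin : ∀ u : (Fin N × Fin N → ℝ) × (Fin N × Fin N → ℝ) × (Fin N × Fin N → ℝ) →
      Fin N × Fin N → ℝ, Continuous u → ∀ σ, Continuous fun ω =>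
      linEnergy (interpCoeff (cavCoeff N β) (bulkCoeff N β) s) (u ω) σ :=
    fun u hu σ => (continuous_linEnergy _ σ).comp hu
  simp only [EgibbsTSn, gibbsTSn_eq_replicaAvg hN, quenchedAvg, interpCoeff_coupledCoeff,
    funext (linEnergy_coupledCoeff t _ _)]
  rw [show disM3 N = _ from (measurePreserving_stdGauss_three (Fin N × Fin N)).map_eq.symm,
    integral_map (measurePreserving_stdGauss_three _).aemeasurable]
  refine Continuous.aestronglyMeasurable (continuous_replicaAvg n (fun ρ => ?_) f)
  exact (hlin _ (by fun_prop) _).add (hlin _ (by fun_prop) _)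

lemma gibbs2_eq_pairAvg (β : ℝ) (g : Fin N × Fin N → ℝ) (f : Config N → Config N → ℝ) :
    gibbs2 N β g f = pairAvg f (gibbsWeight (ham N β g)) (gibbsWeight (ham N β g)) := by
  simp only [gibbs2, pairAvg, gibbsWeight, partFun, Finset.sum_div, Finset.sum_mul, exp_add]
  exact Finset.sum_congr rfl fun _ _ => Finset.sum_congr rfl fun _ _ => by ring

lemma continuous_pairAvg_ham (β : ℝ) (h : Config N → Config N → ℝ) :
    Continuous fun g => pairAvg h (gibbsWeight (ham N β g)) (gibbsWeight (ham N β g)) := by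
  have hw : ∀ σ, Continuous fun g => gibbsWeight (ham N β g) σ := fun σ => by
    have := fun σ => (continuous_linEnergy (interpCoeff (cavCoeff N β) (bulkCoeff N β) 1) σ).congr
      fun g => linEnergy_eq_ham β g σ
    unfold gibbsWeight
    exact (continuous_exp.comp (this σ)).div (by fun_prop) fun g => (sum_exp_pos _).ne'
  unfold pairAvg
  fun_prop

lemma abs_pairAvg_le {h : Config N → Config N → ℝ} (H : Config N → ℝ) :
    |pairAvg h (gibbsWeight H) (gibbsWeight H)| ≤ ∑ σ, ∑ τ, |h σ τ| := by
  refine (Finset.abs_sum_le_sum_abs _ _).trans (Finset.sum_le_sum fun σ _ => ?_)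
  rw [abs_mul, abs_of_nonneg (gibbsWeight_nonneg H σ)]
  refine (mul_le_of_le_one_right (abs_nonneg _) (gibbsWeight_le_one H σ)).trans
    ((Finset.abs_sum_le_sum_abs _ _).trans (Finset.sum_le_sum fun τ _ => ?_))
  rw [abs_mul, abs_of_nonneg (gibbsWeight_nonneg H τ)]
  exact mul_le_of_le_one_right (abs_nonneg _) (gibbsWeight_le_one H τ)

lemma integrable_pairAvg_ham (β : ℝ) (h : Config N → Config N → ℝ) :
    Integrable (fun g => pairAvg h (gibbsWeight (ham N β g)) (gibbsWeight (ham N β g)))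
      (stdGauss (Fin N × Fin N)) :=
  integrable_of_continuous_of_bounded (continuous_pairAvg_ham β h) fun _ => abs_pairAvg_le _

lemma quenchedAvg_pairKernel_pow_le {β t : ℝ} (hβ : β ∈ Set.Icc (0 : ℝ) 1)
    (ht : t ∈ Set.Icc (0 : ℝ) 1) {n p : ℕ} (hp : Even p) (i i' : Fin n) :
    quenchedAvg n (interpCoeff (coupledCoeff t (cavCoeff N β)) (coupledCoeff t (bulkCoeff N β)) 1)
        (fun ρ => |pairKernel (Ufun N β t) (Udiag N β t) ρ i i'| ^ p) ≤
      2 ^ p * Egibbs2 N β fun σ τ => |ovlp N σ τ| ^ p := by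
  set D : (Fin N × Fin N → ℝ) → ℝ := fun g => pairAvg (fun σ τ => |ovlp N σ τ| ^ p)
    (gibbsWeight (ham N β g)) (gibbsWeight (ham N β g))
  have hDi : Integrable D (stdGauss (Fin N × Fin N)) := integrable_pairAvg_ham β _
  have hE : Egibbs2 N β (fun σ τ => |ovlp N σ τ| ^ p) = ∫ g, D g ∂stdGauss (Fin N × Fin N) := by
    simp only [Egibbs2, gibbs2_eq_pairAvg]
    rfl
  have h1 := measurePreserving_rotate_fst ht (Fin N × Fin N)
  have h2 := measurePreserving_rotate_snd ht (Fin N × Fin N)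
  have hi1 := h1.integrable_comp_of_integrable hDi
  have hi2 := h2.integrable_comp_of_integrable hDi
  have he1 := integral_map h1.aemeasurable (h1.map_eq ▸ hDi.aestronglyMeasurable)
  have he2 := integral_map h2.aemeasurable (h2.map_eq ▸ hDi.aestronglyMeasurable)
  rw [h1.map_eq] at he1
  rw [h2.map_eq] at he2
  have hle := integral_mono (integrable_replicaAvg n _ _)
    (((hi1.add hi2).div_const 2).const_mul (2 ^ p)) fun x => (by
      rw [interpCoeff_coupledCoeff, funext (linEnergy_coupledCoeff t _ x),
        funext (linEnergy_eq_ham β _), funext (linEnergy_eq_ham β _)]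
      exact replicaAvg_pairKernel_pow_le hβ ht hp _ _ i i' :
        replicaAvg n (linEnergy (interpCoeff (coupledCoeff t (cavCoeff N β))
          (coupledCoeff t (bulkCoeff N β)) 1) x)
          (fun ρ => |pairKernel (Ufun N β t) (Udiag N β t) ρ i i'| ^ p) ≤ _)
  refine hle.trans_eq ?_
  rw [integral_const_mul, integral_div, integral_add' hi1 hi2, hE]
  simp only [Function.comp_apply, ← he1, ← he2, add_self_div_two]

end Cavity

/-- A function constant on the negative half-line has vanishing iterated derivatives at `0`,
with the convention that the derivative is `0` where it does not exist. -/
lemma iteratedDeriv_zero_of_const {F : ℝ → ℝ} {c : ℝ} (hF : ∀ s ≤ 0, F s = c) {m : ℕ} (hm : 1 ≤ m) :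
    iteratedDeriv m F 0 = 0 := by
  have key : ∀ (G : ℝ → ℝ) (c : ℝ), (∀ s < 0, G s = c) → deriv G 0 = 0 := by
    intro G c hG
    by_cases hd : DifferentiableAt ℝ G 0
    · have h0 : G 0 = c := tendsto_nhds_unique
        (hd.continuousAt.continuousWithinAt (s := Set.Iio 0))
        (tendsto_const_nhds.congr' (eventually_nhdsWithin_of_forall fun s hs => (hG s hs).symm))
      have h1 := hd.hasDerivAt.hasDerivWithinAt (s := Set.Iic 0)
      have h2 : HasDerivWithinAt G 0 (Set.Iic 0) 0 :=
        (hasDerivWithinAt_const _ _ c).congr (fun s hs => hs.lt_or_eq.elim (hG s) fun h => h ▸ h0)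
          h0
      exact (uniqueDiffWithinAt_Iic 0).eq_deriv _ h1 h2
    · exact deriv_zero_of_not_differentiableAt hd
  have hneg : ∀ m, ∃ c, ∀ s < 0, iteratedDeriv m F s = c := by
    intro m
    induction m with
    | zero => exact ⟨c, fun s hs => by simpa using hF s hs.le⟩
    | succ m ih =>
      obtain ⟨c', hc'⟩ := ih
      refine ⟨0, fun s hs => ?_⟩
      rw [iteratedDeriv_succ]
      have : iteratedDeriv m F =ᶠ[nhds s] fun _ => c' :=
        (eventually_lt_nhds hs).mono hc'
      rw [this.deriv_eq, deriv_const]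
  obtain ⟨m, rfl⟩ := Nat.exists_eq_add_of_le' hm
  obtain ⟨c', hc'⟩ := hneg m
  rw [iteratedDeriv_succ]
  exact key _ c' hc'

/-- Hölder-type bound on the `m`-th `s`-derivative of `E⟨f⟩_{t,s}` in
terms of `(E⟨|f|^{r₁}⟩_t)^{1/r₁}` and overlap moments. -/
theorem sk_cavity_deriv_bound (n m : ℕ) (hm : 1 ≤ m) :
    ∃ K : ℝ, ∀ N : ℕ, 1 ≤ N →
      ∀ f : (Fin n → Config N × Config N) → ℝ,
      ∀ β ∈ Set.Icc (0 : ℝ) 1, ∀ t ∈ Set.Icc (0 : ℝ) 1, ∀ s ∈ Set.Icc (0 : ℝ) 1,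
      ∀ r₁ r₂ : ℝ, 0 < r₁ → 0 < r₂ → 1 / r₁ + 1 / r₂ = 1 →
      (∃ k : ℕ, (m : ℝ) * r₂ = 2 * k) →
      |iteratedDeriv m (fun s' => EgibbsTSn N β t s' f) s| ≤
        K * (EgibbsTSn N β t 1 (fun ρ => |f ρ| ^ r₁)) ^ (1 / r₁) *
          (Egibbs2 N β (fun σ τ => |ovlp N σ τ| ^ ((m : ℝ) * r₂))) ^ (1 / r₂) := by
  set n' : ℕ := n + 2 * m
  set M : ℝ := ((n' : ℝ) + 1) * (n' + 2) * (((n' + 2 : ℕ) : ℝ) ^ 2 * 2)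
  refine ⟨iterConst n m * exp M * (((n' : ℕ) : ℝ) ^ 2 * 2) ^ m, ?_⟩
  intro N hN f β hβ t ht s hs r₁ r₂ hr₁ hr₂ hr ⟨k, hk⟩
  have hconj : r₁.HolderConjugate r₂ := by
    rw [Real.holderConjugate_iff]
    refine ⟨?_, by simpa using hr⟩
    have : 0 < 1 / r₂ := by positivity
    have h1 : 1 / r₁ < 1 := by linarith
    rwa [div_lt_one hr₁] at h1
  have hp : 1 ≤ 2 * k := by
    have : (0 : ℝ) < 2 * k := hk ▸ mul_pos (Nat.cast_pos.2 hm) hr₂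
    have : 0 < 2 * k := by exact_mod_cast this
    exact this
  have hW : (fun σ τ => |ovlp N σ τ| ^ ((m : ℝ) * r₂)) =
      fun σ τ => |ovlp N σ τ| ^ (2 * k) := by
    funext σ τ
    rw [hk, ← rpow_natCast]
    norm_cast
  have hW0 : 0 ≤ Egibbs2 N β fun σ τ => |ovlp N σ τ| ^ (2 * k) :=
    integral_nonneg fun g => by unfold gibbs2; positivity
  rw [hW]
  simp only [EgibbsTSn_eq_quenchedAvg hN]
  rcases hs.1.eq_or_lt with rfl | hs0
  · rw [iteratedDeriv_zero_of_const (c := quenchedAvg n (coupledCoeff t (bulkCoeff N β)) f)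
      (fun s hs => congrArg (quenchedAvg n · f) (by
        funext j ρ; simp [interpCoeff, sqrt_eq_zero_of_nonpos hs])) hm, abs_zero]
    have := iterConst_nonneg n m
    have := quenchedAvg_nonneg n (interpCoeff (coupledCoeff t (cavCoeff N β))
      (coupledCoeff t (bulkCoeff N β)) 1) (f := fun ρ => |f ρ| ^ r₁) fun ρ => by positivity
    positivity
  · have hk2 : ∀ ρ : Config N × Config N, |Udiag N β t ρ| ≤ 2 := fun ρ =>
      (abs_Udiag_le hβ ht ρ).trans ((abs_ovlpm_le_one _ _).trans one_le_two)
    refine abs_iteratedDeriv_quenchedAvg_le n m (U := Ufun N β t) (fun ρ ρ' => ?_) (fun ρ ρ' => ?_)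
      (Ufun_self hN β t) (by positivity) (fun ρ => ?_) f hs0 hs.2 hconj hp (by rw [hk]; norm_cast)
      hW0 two_pos.le (quenchedAvg_pairKernel_pow_le hβ ht (even_two_mul k))
    · simp [sum_coupledCoeff_mul ht, cavCoeff_mul_bulkCoeff]
    · simp only [sum_coupledCoeff_mul ht, sum_cavCoeff_mul hN, Ufun]
      ring
    · exact (abs_derivFactor_le (Ufun_self hN β t) ρ).trans (mul_le_mul_of_nonneg_left
        (kernelSum_le (abs_Ufun_le_two hβ ht) hk2 ρ) (by positivity))

end
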